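/- Assume Hypothesis 3.1 and that C has a bounded everywhere-defined inverse C⁻¹ ∈ L(H). Fix s ∈ [0,T] and a Borel probability measure ζ on H, and define K := { μ ∈ M_{s,ζ} : ∫_s^T ∫_H (|x|⁴ + |F(t,x)|² + |x|⁴|F(t,x)|²) μ_t(dx)dt < ∞ }. Then K contains at most one element; i.e., the Fokker–Planck equation has at most one solution with these moment and drift-integrability properties. -/

import Mathlib

open MeasureTheory Set Filter Topology
open scoped InnerProductSpace ENNReal NNReal

attribute [local instance] Classical.propDecidable

noncomputable section

variable (H : Type) [NormedAddCommGroup H] [InnerProductSpace ℝ H] [CompleteSpace H]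
  [SecondCountableTopology H] [MeasurableSpace H] [BorelSpace H]

/-- All data of the framework: the `C₀`-semigroup `e^{tA}` with its generator `A`
(a densely defined unbounded operator), the diffusion operator `C` (symmetric, nonnegative)
with a square root `C^{1/2}`, a Hilbert basis of `H`, the time horizon `T > 0`, and the
Borel measurable drift `F` defined on a Borel set `DF ⊆ [0,T] × H`. -/
structure FPData where
  T : ℝ
  hT : 0 < T
  S : ℝ → H →L[ℝ] H
  S_zero : S 0 = 1
  S_add : ∀ s t : ℝ, 0 ≤ s → 0 ≤ t → S (s + t) = (S s).comp (S t)
  S_cont : ∀ x : H, ContinuousOn (fun t => S t x) (Ici (0 : ℝ))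
  A : H →ₗ.[ℝ] H
  A_dense : Dense (A.domain : Set H)
  A_mem_iff : ∀ x : H, x ∈ A.domain ↔
    ∃ y : H, Tendsto (fun t : ℝ => t⁻¹ • (S t x - x)) (𝓝[>] 0) (𝓝 y)
  A_gen : ∀ x : A.domain,
    Tendsto (fun t : ℝ => t⁻¹ • (S t (x : H) - (x : H))) (𝓝[>] 0) (𝓝 (A x))
  C : H →L[ℝ] H
  C_pos : C.IsPositive
  sqrtC : H →L[ℝ] H
  sqrtC_pos : sqrtC.IsPositive
  sqrtC_sq : sqrtC.comp sqrtC = C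
  ι : Type
  basis : HilbertBasis ι ℝ H
  F : ℝ × H → H
  DF : Set (ℝ × H)
  DF_meas : MeasurableSet DF
  F_meas : Measurable F

variable {H}

/-- The spatial gradient `D_x u(t,x)` of a function `u : ℝ × H → ℝ`. -/
def xGrad (u : ℝ × H → ℝ) (p : ℝ × H) : H :=
  gradient (fun z => u (p.1, z)) p.2

/-- The set `Sf` of functions is dense in `L¹([s,T] × H, μ)`. -/
def DenseRangeL1 (μ : Measure (ℝ × H)) (Sf : Set (ℝ × H → ℝ)) : Prop :=
  ∀ f : ℝ × H → ℝ, Integrable f μ → ∀ ε > 0,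
    ∃ g ∈ Sf, Integrable g μ ∧ ∫ p, |f p - g p| ∂μ < ε

namespace FPData

variable (D : FPData H)

/-- `h ∈ C¹([0,T]; D(A*))`, represented by the pair `(h, g)` with `g t = A* (h t)`. -/
def CinDAstar (h g : ℝ → H) : Prop :=
  ContDiffOn ℝ 1 h (Icc 0 D.T) ∧ ContDiffOn ℝ 1 g (Icc 0 D.T) ∧
    ∀ t ∈ Icc 0 D.T, (h t, g t) ∈ D.A.adjoint.graph

/-- Generators of `E_A([0,T] × H)`: real parts of `φ(t) e^{i⟨x, h(t)⟩}`. -/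
def EAgen : Set (ℝ × H → ℝ) :=
  {u | ∃ (φ : ℝ → ℝ) (h g : ℝ → H), ContDiffOn ℝ 1 φ (Icc 0 D.T) ∧ φ D.T = 0 ∧
    D.CinDAstar h g ∧
    (u = (fun p => φ p.1 * Real.cos ⟪p.2, h p.1⟫_ℝ) ∨
     u = (fun p => φ p.1 * Real.sin ⟪p.2, h p.1⟫_ℝ))}

/-- The space of test functions `E_A([0,T] × H) = D(L₀)`: the linear span of the generators. -/
def EA : Set (ℝ × H → ℝ) := ↑(Submodule.span ℝ D.EAgen)

/-- The trace term `Tr[C D²_x u(t,x)] = Σ_i ⟨D²_x u(t,x)(C^{1/2} e_i), C^{1/2} e_i⟩`. -/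
def traceCD2 (u : ℝ × H → ℝ) (p : ℝ × H) : ℝ :=
  ∑' i : D.ι,
    ⟪(fderiv ℝ (gradient fun z => u (p.1, z)) p.2) (D.sqrtC (D.basis i)),
      D.sqrtC (D.basis i)⟫_ℝ

/-- The Ornstein–Uhlenbeck part `V₀u = D_t u + (1/2)Tr[C D²_x u] + ⟨x, A* D_x u⟩`
of the Kolmogorov operator. -/
def Vzero (u : ℝ × H → ℝ) (p : ℝ × H) : ℝ :=
  deriv (fun r => u (r, p.2)) p.1 + (1 / 2) * D.traceCD2 u p +
    (if hk : xGrad u p ∈ D.A.adjoint.domain then ⟪p.2, D.A.adjoint ⟨xGrad u p, hk⟩⟫_ℝ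
     else 0)

/-- The Kolmogorov operator `L₀u = V₀u + ⟨F(t,x), D_x u⟩`. -/
def Lzero (u : ℝ × H → ℝ) (p : ℝ × H) : ℝ :=
  D.Vzero u p + ⟪D.F p, xGrad u p⟫_ℝ

/-- `|F(t,x)|`, with the convention `|F(t,x)| = +∞` outside `D(F)`. -/
def FnormE (p : ℝ × H) : ℝ≥0∞ := if p ∈ D.DF then (‖D.F p‖₊ : ℝ≥0∞) else ⊤

/-- Condition (1.6): `∫ (|⟨y, A*h(t)⟩| + |F(t,y)|) dμ < ∞` for all `h ∈ C¹([0,T]; D(A*))`. -/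
def DriftIntegrable (μ : Measure (ℝ × H)) : Prop :=
  ∀ h g : ℝ → H, D.CinDAstar h g →
    ∫⁻ p, ((‖⟪p.2, g p.1⟫_ℝ‖₊ : ℝ≥0∞) + D.FnormE p) ∂μ < ⊤

/-- `μ(dt,dx) = μ_t(dx) dt` on `[s,T] × H` for a measurable kernel `(μ_t)`. -/
def IsKernel (s : ℝ) (μ : Measure (ℝ × H)) (μt : ℝ → Measure H) : Prop :=
  (∀ B : Set H, MeasurableSet B → Measurable fun t => μt t B) ∧
  ∀ E : Set (ℝ × H), MeasurableSet E → μ E = ∫⁻ t in Icc s D.T, μt t {x | (t, x) ∈ E}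

/-- `μ = μ_t dt` is a solution of the Fokker–Planck equation (1.5) with initial condition
`ζ` at time `s` (membership in `M_{s,ζ}`). -/
def IsFPSol (s : ℝ) (ζ : Measure H) (μ : Measure (ℝ × H)) (μt : ℝ → Measure H) : Prop :=
  (∀ t ∈ Icc s D.T, IsProbabilityMeasure (μt t)) ∧
  D.IsKernel s μ μt ∧ D.DriftIntegrable μ ∧
  ∀ u ∈ D.EA, ∀ᵐ t ∂(volume.restrict (Icc s D.T)),
    ∫ y, u (t, y) ∂(μt t) =
      ∫ y, u (s, y) ∂ζ + ∫ r in Icc s t, (∫ y, D.Lzero u (r, y) ∂(μt r))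

/-- The set `M_{s,ζ}` of solutions of the Fokker–Planck equation. -/
def Mset (s : ℝ) (ζ : Measure H) : Set (Measure (ℝ × H)) :=
  {μ | ∃ μt : ℝ → Measure H, D.IsFPSol s ζ μ μt}

/-- Membership in `M_s^λ` (formula (4.2)): `ν = ν_t dt` is a finite nonnegative measure with
`∫ L₀ u dν ≤ 2λ ∫ u dν` for all nonnegative `u ∈ E_A`. -/
def IsSubInv (lam s : ℝ) (ν : Measure (ℝ × H)) (νt : ℝ → Measure H) : Prop :=
  (∀ t ∈ Icc s D.T, IsFiniteMeasure (νt t)) ∧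
  D.IsKernel s ν νt ∧ D.DriftIntegrable ν ∧
  ∀ u ∈ D.EA, (∀ p : ℝ × H, p.1 ∈ Icc 0 D.T → 0 ≤ u p) →
    ∫ t in Icc s D.T, (∫ y, D.Lzero u (t, y) ∂(νt t)) ≤
      2 * lam * ∫ t in Icc s D.T, (∫ y, u (t, y) ∂(νt t))

/-- The moment condition `∫_s^T ∫_H (|x|⁴ + |F(t,x)|² + |x|⁴|F(t,x)|²) ν_t(dx) dt < ∞`. -/
def moment2 (s : ℝ) (νt : ℝ → Measure H) : Prop :=
  ∫⁻ t in Icc s D.T, (∫⁻ y, (ENNReal.ofReal (‖y‖ ^ 4) + (D.FnormE (t, y)) ^ 2 +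
    ENNReal.ofReal (‖y‖ ^ 4) * (D.FnormE (t, y)) ^ 2) ∂(νt t)) < ⊤

/-- The moment condition `∫_s^T ∫_H (|x|² + |F(t,x)| + |x|²|F(t,x)|) ν_t(dx) dt < ∞`. -/
def moment1 (s : ℝ) (νt : ℝ → Measure H) : Prop :=
  ∫⁻ t in Icc s D.T, (∫⁻ y, (ENNReal.ofReal (‖y‖ ^ 2) + D.FnormE (t, y) +
    ENNReal.ofReal (‖y‖ ^ 2) * D.FnormE (t, y)) ∂(νt t)) < ⊤

/-- Hypothesis 3.1: dissipativity of `A`, trace class `Q_t = ∫_0^t e^{sA} C e^{sA*} ds`,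
and the smoothing condition `e^{tA}(H) ⊆ Q_t^{1/2}(H)` with `Λ_t := (Q_t^{1/2})^{-1} e^{tA}`
satisfying `∫_0^∞ e^{-λt} ‖Λ_t‖ dt < ∞` for `λ` large enough. -/
structure Hyp31 where
  ω : ℝ
  A_diss : ∀ x : D.A.domain, ⟪D.A x, (x : H)⟫_ℝ ≤ ω * ‖(x : H)‖ ^ 2
  Q : ℝ → H →L[ℝ] H
  Q_def : ∀ t : ℝ, 0 < t → ∀ x : H,
    Q t x = ∫ r in (0 : ℝ)..t, D.S r (D.C ((ContinuousLinearMap.adjoint (D.S r)) x))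
  Q_pos : ∀ t : ℝ, 0 < t → (Q t).IsPositive
  Q_traceClass : ∀ t : ℝ, 0 < t → Summable fun i : D.ι => ⟪Q t (D.basis i), D.basis i⟫_ℝ
  sqrtQ : ℝ → H →L[ℝ] H
  sqrtQ_pos : ∀ t : ℝ, 0 < t → (sqrtQ t).IsPositive
  sqrtQ_sq : ∀ t : ℝ, 0 < t → (sqrtQ t).comp (sqrtQ t) = Q t
  range_incl : ∀ t : ℝ, 0 < t → Set.range (D.S t) ⊆ Set.range (sqrtQ t)
  Λ : ℝ → H →L[ℝ] H
  Λ_spec : ∀ t : ℝ, 0 < t → (sqrtQ t).comp (Λ t) = D.S t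
  lam₀ : ℝ
  Λ_int : ∀ lam : ℝ, lam₀ ≤ lam →
    IntegrableOn (fun t => Real.exp (-lam * t) * ‖Λ t‖) (Ioi 0)

/-- Hypothesis 5.1: `F(t,·)` is the minimal section of an `m`-dissipative graph
`F̄(t,·)`, with `F(t,0) = 0`. -/
structure Hyp51 where
  Fbar : ℝ → H → Set H
  dom_meas : ∀ t ∈ Icc 0 D.T, MeasurableSet {x : H | (Fbar t x).Nonempty}
  K : ℝ
  K_pos : 0 < K
  diss : ∀ t ∈ Icc 0 D.T, ∀ x y u v : H, u ∈ Fbar t x → v ∈ Fbar t y →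
    ⟪u - v, x - y⟫_ℝ ≤ K * ‖x - y‖ ^ 2
  mrange : ∀ t ∈ Icc 0 D.T, ∀ lam : ℝ, K < lam → ∀ z : H,
    ∃ x : H, ∃ w ∈ Fbar t x, lam • x - w = z
  dom_eq : ∀ t ∈ Icc 0 D.T, ∀ x : H, (t, x) ∈ D.DF ↔ (Fbar t x).Nonempty
  minimal : ∀ t ∈ Icc 0 D.T, ∀ x : H, (t, x) ∈ D.DF →
    D.F (t, x) ∈ Fbar t x ∧ ∀ w ∈ Fbar t x, ‖D.F (t, x)‖ ≤ ‖w‖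
  zero_mem : ∀ t ∈ Icc 0 D.T, (t, (0 : H)) ∈ D.DF ∧ D.F (t, 0) = 0

/-- Hypothesis 3.3 for a drift `F₀ : [0,T] × H → H`: continuity, continuous space
derivative, and uniform Lipschitz continuity in the space variable. -/
def Hyp33 (F0 : ℝ × H → H) : Prop :=
  ContinuousOn F0 (Icc 0 D.T ×ˢ (univ : Set H)) ∧
  (∀ t ∈ Icc 0 D.T, ∀ x : H, DifferentiableAt ℝ (fun y => F0 (t, y)) x) ∧
  (∀ t ∈ Icc 0 D.T, Continuous fun x : H => fderiv ℝ (fun y => F0 (t, y)) x) ∧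
  ∃ K > 0, ∀ t ∈ Icc 0 D.T, ∀ x y : H, ‖F0 (t, x) - F0 (t, y)‖ ≤ K * ‖x - y‖

/-- The data of the Ornstein–Uhlenbeck semigroup: the Gaussian measures `N_{Q_t}`
(specified through their characteristic functionals). -/
structure OUData (hyp : D.Hyp31) where
  N : ℝ → Measure H
  N_prob : ∀ t : ℝ, 0 ≤ t → IsProbabilityMeasure (N t)
  N_zero : N 0 = Measure.dirac 0
  N_char : ∀ t : ℝ, 0 < t → ∀ h : H,
    ∫ x, Complex.exp ((⟪x, h⟫_ℝ : ℂ) * Complex.I) ∂(N t) =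
      Complex.exp (-((⟪hyp.Q t h, h⟫_ℝ : ℂ)) / 2)

end FPData

namespace FPData.OUData

variable {H : Type} [NormedAddCommGroup H] [InnerProductSpace ℝ H] [CompleteSpace H]
  [SecondCountableTopology H] [MeasurableSpace H] [BorelSpace H]
  {D : FPData H} {hyp : D.Hyp31}

/-- The Ornstein–Uhlenbeck semigroup `R_t φ(x) = ∫_H φ(e^{tA} x + y) N_{Q_t}(dy)`. -/
def Rop (O : D.OUData hyp) (t : ℝ) (φ : H → ℝ) (x : H) : ℝ :=
  ∫ y, φ (D.S t x + y) ∂(O.N t)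

/-- The resolvent `G̃_λ f(x) = ∫_0^∞ e^{-λt} R_t f(x) dt` of the OU semigroup. -/
def Gtilde (O : D.OUData hyp) (lam : ℝ) (f : H → ℝ) (x : H) : ℝ :=
  ∫ t in Ioi (0 : ℝ), Real.exp (-lam * t) * O.Rop t f x

/-- The resolvent `G_λ f(t,x) = ∫_t^T e^{-λ(r-t)} R_{r-t} f(r,·)(x) dr` of the
time-dependent OU operator `V`; by definition `u ∈ D(V)` iff `u = G_λ f` for some `λ` and
some `f ∈ C([0,T]; C_{u,2}(H))`, and then `Vu = λu - f`. -/
def Gop (O : D.OUData hyp) (lam : ℝ) (f : ℝ → H → ℝ) (p : ℝ × H) : ℝ :=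
  ∫ r in p.1..D.T, Real.exp (-lam * (r - p.1)) * O.Rop (r - p.1) (f r) p.2

end FPData.OUData

section Spaces

variable {H : Type} [NormedAddCommGroup H] [InnerProductSpace ℝ H] [CompleteSpace H]

/-- Membership in `C_{u,2}(H)`: `x ↦ φ(x)/(1+|x|²)` is uniformly continuous and bounded. -/
def MemCu2 (φ : H → ℝ) : Prop :=
  UniformContinuous (fun x : H => φ x / (1 + ‖x‖ ^ 2)) ∧
    ∃ M : ℝ, ∀ x : H, |φ x| ≤ M * (1 + ‖x‖ ^ 2)

/-- The norm of `C_{u,2}(H)`: `‖φ‖ = sup_x |φ(x)|/(1+|x|²)`. -/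
def cu2Norm (φ : H → ℝ) : ℝ := ⨆ x : H, |φ x| / (1 + ‖x‖ ^ 2)

/-- The sup norm `‖f‖_∞ = sup_x |f(x)|`. -/
def supNorm (f : H → ℝ) : ℝ := ⨆ x : H, |f x|

/-- Membership in `C¹_u(H)`: bounded and uniformly continuous together with the
(Fréchet) derivative. -/
def MemC1u (φ : H → ℝ) : Prop :=
  UniformContinuous φ ∧ (∃ M : ℝ, ∀ x : H, |φ x| ≤ M) ∧ Differentiable ℝ φ ∧
    UniformContinuous (gradient φ) ∧ ∃ M : ℝ, ∀ x : H, ‖gradient φ x‖ ≤ M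

/-- Membership in `C_u(H,H)`: bounded and uniformly continuous `H → H`. -/
def MemCuHH (Φ : H → H) : Prop := UniformContinuous Φ ∧ ∃ M : ℝ, ∀ x : H, ‖Φ x‖ ≤ M

end Spaces

namespace FPData

variable {H : Type} [NormedAddCommGroup H] [InnerProductSpace ℝ H] [CompleteSpace H]
  [SecondCountableTopology H] [MeasurableSpace H] [BorelSpace H] (D : FPData H)

/-- Membership in `C([0,T]; C_{u,2}(H))`. -/
def MemCT (f : ℝ → H → ℝ) : Prop :=
  (∀ t ∈ Icc 0 D.T, MemCu2 (f t)) ∧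
  ∀ t₀ ∈ Icc 0 D.T, ∀ ε > 0, ∃ δ > 0, ∀ t ∈ Icc 0 D.T, |t - t₀| < δ →
    ∀ x : H, |f t x - f t₀ x| ≤ ε * (1 + ‖x‖ ^ 2)

/-- Membership in `C([0,T]; C¹_u(H))`. -/
def MemCTC1u (f : ℝ → H → ℝ) : Prop :=
  (∀ t ∈ Icc 0 D.T, MemC1u (f t)) ∧
  ∀ t₀ ∈ Icc 0 D.T, ∀ ε > 0, ∃ δ > 0, ∀ t ∈ Icc 0 D.T, |t - t₀| < δ →
    ∀ x : H, |f t x - f t₀ x| + ‖gradient (f t) x - gradient (f t₀) x‖ ≤ ε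

/-- `D_x u ∈ C([0,T]; C_u(H,H))`. -/
def GradInCTCuHH (u : ℝ × H → ℝ) : Prop :=
  (∀ t ∈ Icc 0 D.T, MemCuHH fun x : H => xGrad u (t, x)) ∧
  ∀ t₀ ∈ Icc 0 D.T, ∀ ε > 0, ∃ δ > 0, ∀ t ∈ Icc 0 D.T, |t - t₀| < δ →
    ∀ x : H, ‖xGrad u (t, x) - xGrad u (t₀, x)‖ ≤ ε

end FPData

end

set_option linter.unusedSectionVars false

section AdjointOrbits

open ContinuousLinearMap (adjoint)

variable {H : Type} [NormedAddCommGroup H] [InnerProductSpace ℝ H] [CompleteSpace H]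
  [SecondCountableTopology H] [MeasurableSpace H] [BorelSpace H]

namespace FPData

variable (D : FPData H)

/-- A `C₀`-semigroup is bounded on bounded time intervals. -/
theorem exists_norm_S_le (R : ℝ) : ∃ M : ℝ, 0 < M ∧ ∀ t ∈ Icc 0 R, ‖D.S t‖ ≤ M := by
  obtain ⟨M, hM⟩ := banach_steinhaus (g := fun t : Icc (0 : ℝ) R => D.S t) (fun x => by
    obtain ⟨K, hK⟩ := isCompact_Icc.exists_bound_of_continuousOn
      ((D.S_cont x).mono (fun t (ht : t ∈ Icc 0 R) => ht.1))
    exact ⟨K, fun t => hK t t.2⟩)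
  exact ⟨max M 1, by positivity, fun t ht => (hM ⟨t, ht⟩).trans (le_max_left _ _)⟩

theorem continuous_S_max (x : H) : Continuous fun r : ℝ => D.S (max r 0) x :=
  (D.S_cont x).comp_continuous (by fun_prop) fun r => le_max_right r 0

/-- The primitive `∫₀^σ e^{rA*} κ dr` of an adjoint orbit, defined weakly. -/
noncomputable def adjointPrimitive (κ : H) (σ : ℝ) : H :=
  (InnerProductSpace.toDual ℝ H).symm
    (LinearMap.mkContinuous
      { toFun := fun x => ∫ r in (0 : ℝ)..σ, ⟪κ, D.S (max r 0) x⟫_ℝ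
        map_add' := fun x y => by
          simp only [map_add, inner_add_right]
          exact intervalIntegral.integral_add
            ((continuous_const.inner (D.continuous_S_max x)).intervalIntegrable _ _)
            ((continuous_const.inner (D.continuous_S_max y)).intervalIntegrable _ _)
        map_smul' := fun c x => by
          simp only [map_smul, inner_smul_right, intervalIntegral.integral_const_mul,
            RingHom.id_apply, smul_eq_mul] }
      (‖κ‖ * (D.exists_norm_S_le |σ|).choose * |σ|)
      (fun x => by
        obtain ⟨_, h⟩ := (D.exists_norm_S_le |σ|).choose_spec
        have key : ∀ r ∈ Set.uIoc 0 σ, ‖⟪κ, D.S (max r 0) x⟫_ℝ‖ ≤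
            ‖κ‖ * ((D.exists_norm_S_le |σ|).choose * ‖x‖) := by
          intro r hr
          refine (norm_inner_le_norm _ _).trans ?_
          gcongr
          refine (D.S _).le_of_opNorm_le (h _ ⟨le_max_right _ _, max_le ?_ (abs_nonneg _)⟩) x
          rcases le_total 0 σ with h0 | h0
          · rw [Set.uIoc_of_le h0] at hr; exact hr.2.trans (le_abs_self _)
          · rw [Set.uIoc_of_ge h0] at hr; exact hr.2.trans (abs_nonneg _)
        have := intervalIntegral.norm_integral_le_of_norm_le_const key
        simp only [sub_zero] at this
        calc _ ≤ _ := this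
          _ = _ := by ring))

theorem inner_adjointPrimitive (κ : H) (σ : ℝ) (x : H) :
    ⟪D.adjointPrimitive κ σ, x⟫_ℝ = ∫ r in (0 : ℝ)..σ, ⟪κ, D.S (max r 0) x⟫_ℝ := by
  rw [adjointPrimitive, InnerProductSpace.toDual_symm_apply]
  rfl

theorem inner_adjointPrimitive_sub (κ : H) (σ σ' : ℝ) (x : H) :
    ⟪D.adjointPrimitive κ σ' - D.adjointPrimitive κ σ, x⟫_ℝ =
      ∫ r in σ..σ', ⟪κ, D.S (max r 0) x⟫_ℝ := by
  have hc := continuous_const (y := κ) |>.inner (𝕜 := ℝ) (D.continuous_S_max x)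
  rw [inner_sub_left, inner_adjointPrimitive, inner_adjointPrimitive,
    intervalIntegral.integral_interval_sub_left (hc.intervalIntegrable _ _)
      (hc.intervalIntegrable _ _)]

theorem continuous_adjointPrimitive (κ : H) : Continuous (D.adjointPrimitive κ) := by
  refine continuous_iff_continuousAt.2 fun σ₀ => ?_
  obtain ⟨M, hM0, hM⟩ := D.exists_norm_S_le (|σ₀| + 1)
  have hlip : LipschitzOnWith (‖κ‖₊ * M.toNNReal) (D.adjointPrimitive κ)
      (Icc (-(|σ₀| + 1)) (|σ₀| + 1)) := by
    refine LipschitzOnWith.of_dist_le_mul fun σ hσ σ' hσ' => ?_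
    rw [dist_comm, dist_eq_norm, dist_comm, Real.dist_eq]
    set v := D.adjointPrimitive κ σ' - D.adjointPrimitive κ σ with hv
    have h1 : ⟪v, v⟫_ℝ ≤ ‖κ‖ * (M * ‖v‖) * |σ' - σ| := by
      nth_rw 1 [hv]
      rw [inner_adjointPrimitive_sub]
      refine (Real.le_norm_self _).trans
        (intervalIntegral.norm_integral_le_of_norm_le_const fun r hr => ?_)
      refine (norm_inner_le_norm _ _).trans ?_
      gcongr
      refine (D.S _).le_of_opNorm_le (hM _ ⟨le_max_right _ _, max_le ?_ (by positivity)⟩) v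
      exact hr.2.trans (max_le hσ.2 hσ'.2)
    rw [real_inner_self_eq_norm_sq] at h1
    simp only [NNReal.coe_mul, coe_nnnorm, Real.coe_toNNReal _ hM0.le]
    rcases (norm_nonneg v).eq_or_lt with h0 | h0
    · rw [← h0]; positivity
    · nlinarith
  refine hlip.continuousOn.continuousAt (Icc_mem_nhds ?_ ?_)
  · linarith [neg_abs_le σ₀]
  · linarith [le_abs_self σ₀]

/-- `f` is a continuous orbit of the adjoint semigroup whose starting point is an average of
`e^{rA*} κ` over `r ∈ [0, L]`. -/
structure AdjointOrbit (κ : H) (L : ℝ) (f : ℝ → H) : Prop where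
  cont : Continuous f
  flow : ∀ σ τ, 0 ≤ σ → 0 ≤ τ → adjoint (D.S τ) (f σ) = f (σ + τ)
  near : ∀ σ, 0 ≤ σ → ∀ (x : H) (θ : ℝ), (∀ r ∈ Icc σ (σ + L), |⟪κ, D.S r x - x⟫_ℝ| ≤ θ) →
    |⟪f σ - κ, x⟫_ℝ| ≤ θ

theorem abs_average_le {ε θ σ : ℝ} (hε : 0 < ε) {g : ℝ → ℝ}
    (h : ∀ r ∈ Icc σ (σ + ε), |g r| ≤ θ) : |ε⁻¹ * ∫ r in σ..σ + ε, g r| ≤ θ := by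
  have := intervalIntegral.norm_integral_le_of_norm_le_const (a := σ) (b := σ + ε) (f := g)
    (C := θ) fun r hr => h r (by
      rw [Set.uIoc_of_le (by linarith)] at hr; exact ⟨hr.1.le, hr.2⟩)
  rw [add_sub_cancel_left, abs_of_pos hε, Real.norm_eq_abs] at this
  rw [abs_mul, abs_of_pos (inv_pos.2 hε), inv_mul_le_iff₀ hε]
  linarith

theorem adjointOrbit_primitive (κ : H) {ε : ℝ} (hε : 0 < ε) :
    D.AdjointOrbit κ ε fun σ =>
      ε⁻¹ • (D.adjointPrimitive κ (σ + ε) - D.adjointPrimitive κ σ) where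
  cont := by
    have := D.continuous_adjointPrimitive κ
    fun_prop
  flow σ τ hσ hτ := by
    refine ext_inner_right ℝ fun x => ?_
    rw [ContinuousLinearMap.adjoint_inner_left, inner_smul_left, inner_smul_left,
      inner_adjointPrimitive_sub, inner_adjointPrimitive_sub]
    congr 1
    have : σ + τ + ε = σ + ε + τ := by ring
    rw [this, ← intervalIntegral.integral_comp_add_right _ τ]
    refine intervalIntegral.integral_congr fun r hr => ?_
    rw [uIcc_of_le (by linarith)] at hr
    have hr0 : 0 ≤ r := hσ.trans hr.1
    simp only [max_eq_left hr0, max_eq_left (add_nonneg hr0 hτ), D.S_add r τ hr0 hτ,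
      ContinuousLinearMap.comp_apply]
  near σ hσ x θ h := by
    have e : ⟪ε⁻¹ • (D.adjointPrimitive κ (σ + ε) - D.adjointPrimitive κ σ) - κ, x⟫_ℝ =
        ε⁻¹ * ∫ r in σ..σ + ε, ⟪κ, D.S (max r 0) x - x⟫_ℝ := by
      rw [inner_sub_left, inner_smul_left, inner_adjointPrimitive_sub]
      simp only [inner_sub_right]
      rw [intervalIntegral.integral_sub
        ((continuous_const.inner (D.continuous_S_max x)).intervalIntegrable _ _) (by simp)]
      simp [mul_sub, hε.ne']
    rw [e]
    refine abs_average_le hε fun r hr => ?_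
    rw [max_eq_left (hσ.trans hr.1)]
    exact h r hr

theorem AdjointOrbit.average {κ : H} {L ε : ℝ} {f : ℝ → H} (hf : D.AdjointOrbit κ L f)
    (hε : 0 < ε) :
    D.AdjointOrbit κ (L + ε) fun σ => ε⁻¹ • ∫ r in σ..σ + ε, f r where
  cont := by
    have : (fun σ => ε⁻¹ • ∫ r in σ..σ + ε, f r) = fun σ =>
        ε⁻¹ • ((∫ r in (0 : ℝ)..σ + ε, f r) - ∫ r in (0 : ℝ)..σ, f r) := by
      funext σ
      rw [intervalIntegral.integral_interval_sub_left (hf.cont.intervalIntegrable _ _)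
        (hf.cont.intervalIntegrable _ _)]
    rw [this]
    have h1 : Continuous fun σ => ∫ r in (0 : ℝ)..σ, f r :=
      intervalIntegral.continuous_primitive (fun a b => hf.cont.intervalIntegrable a b) 0
    have h2 := h1.comp (continuous_add_const ε)
    exact (h2.sub h1).const_smul _
  flow σ τ hσ hτ := by
    rw [map_smul, ← ContinuousLinearMap.intervalIntegral_comp_comm _
      (hf.cont.intervalIntegrable _ _)]
    congr 1
    have : σ + τ + ε = σ + ε + τ := by ring
    rw [this, ← intervalIntegral.integral_comp_add_right _ τ]
    refine intervalIntegral.integral_congr fun r hr => ?_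
    rw [uIcc_of_le (by linarith)] at hr
    exact hf.flow r τ (hσ.trans hr.1) hτ
  near σ hσ x θ h := by
    have e : ⟪(ε⁻¹ • ∫ r in σ..σ + ε, f r) - κ, x⟫_ℝ =
        ε⁻¹ * ∫ r in σ..σ + ε, ⟪f r - κ, x⟫_ℝ := by
      have h1 : (∫ r in σ..σ + ε, ⟪f r - κ, x⟫_ℝ) = ⟪∫ r in σ..σ + ε, (f r - κ), x⟫_ℝ := by
        simp_rw [real_inner_comm x]
        exact ContinuousLinearMap.intervalIntegral_comp_comm (innerSL ℝ x)
          ((hf.cont.sub continuous_const).intervalIntegrable _ _)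
      rw [h1, intervalIntegral.integral_sub (hf.cont.intervalIntegrable _ _) (by simp)]
      simp [inner_sub_left, inner_smul_left, mul_sub, hε.ne']
    rw [e]
    refine abs_average_le hε fun r hr => hf.near r (hσ.trans hr.1) x θ fun r' hr' => ?_
    exact h r' ⟨hr.1.trans hr'.1, hr'.2.trans (by linarith [hr.2])⟩

theorem hasDerivAt_average {ε : ℝ} {f : ℝ → H} (hf : Continuous f) (σ : ℝ) :
    HasDerivAt (fun σ => ε⁻¹ • ∫ r in σ..σ + ε, f r) (ε⁻¹ • (f (σ + ε) - f σ)) σ := by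
  have : (fun σ => ε⁻¹ • ∫ r in σ..σ + ε, f r) = fun σ =>
      ε⁻¹ • ((∫ r in (0 : ℝ)..σ + ε, f r) - ∫ r in (0 : ℝ)..σ, f r) := by
    funext σ
    rw [intervalIntegral.integral_interval_sub_left (hf.intervalIntegrable _ _)
      (hf.intervalIntegrable _ _)]
  rw [this]
  have h1 : ∀ σ, HasDerivAt (fun σ => ∫ r in (0 : ℝ)..σ, f r) (f σ) σ := fun σ =>
    intervalIntegral.integral_hasDerivAt_right (hf.intervalIntegrable _ _)
      hf.stronglyMeasurable.stronglyMeasurableAtFilter hf.continuousAt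
  exact (((h1 (σ + ε)).comp_add_const σ ε).sub (h1 σ)).const_smul _

theorem contDiff_one_of_hasDerivAt {E : Type*} [NormedAddCommGroup E] [NormedSpace ℝ E]
    {f f' : ℝ → E} (h : ∀ t, HasDerivAt f (f' t) t) (hc : Continuous f') :
    ContDiff ℝ 1 f := by
  rw [contDiff_one_iff_deriv]
  refine ⟨fun t => (h t).differentiableAt, ?_⟩
  rwa [show deriv f = f' from funext fun t => (h t).deriv]

/-- Every vector `κ` is weakly approximated by smooth vectors of the adjoint semigroup. -/
theorem exists_smooth_orbit (κ : H) {ε : ℝ} (hε : 0 < ε) :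
    ∃ f f' : ℝ → H, D.AdjointOrbit κ (3 * ε) f ∧ ContDiff ℝ 1 f ∧ ContDiff ℝ 1 f' ∧
      (∀ σ, HasDerivAt f (f' σ) σ) ∧ ∀ σ, 0 ≤ σ → (f σ, f' σ) ∈ D.A.adjoint.graph := by
  have h0 := D.adjointOrbit_primitive κ hε
  set f0 : ℝ → H := fun σ =>
      ε⁻¹ • (D.adjointPrimitive κ (σ + ε) - D.adjointPrimitive κ σ) with hf0
  have h1 := h0.average D hε
  have d1 : ∀ σ, HasDerivAt (fun σ => ε⁻¹ • ∫ r in σ..σ + ε, f0 r) (ε⁻¹ • (f0 (σ + ε) - f0 σ)) σ :=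
    fun σ => hasDerivAt_average h0.cont σ
  set f1 : ℝ → H := fun σ => ε⁻¹ • ∫ r in σ..σ + ε, f0 r with hf1
  have h2 := h1.average D hε
  have d2 : ∀ σ, HasDerivAt (fun σ => ε⁻¹ • ∫ r in σ..σ + ε, f1 r) (ε⁻¹ • (f1 (σ + ε) - f1 σ)) σ :=
    fun σ => hasDerivAt_average h1.cont σ
  set f2 : ℝ → H := fun σ => ε⁻¹ • ∫ r in σ..σ + ε, f1 r
  have c0 := h0.cont
  have c1 : ContDiff ℝ 1 f1 := contDiff_one_of_hasDerivAt d1 (by fun_prop)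
  have c1' := h1.cont
  refine ⟨f2, fun σ => ε⁻¹ • (f1 (σ + ε) - f1 σ), ?_, contDiff_one_of_hasDerivAt d2 (by fun_prop),
    by fun_prop, d2, fun σ hσ => ?_⟩
  · convert h2 using 1; ring
  · clear_value f2
    have key : ∀ x : D.A.domain, ⟪ε⁻¹ • (f1 (σ + ε) - f1 σ), (x : H)⟫_ℝ = ⟪f2 σ, D.A x⟫_ℝ := by
      intro x
      have t1 : Tendsto (fun t : ℝ => ⟪f2 σ, t⁻¹ • (D.S t (x : H) - (x : H))⟫_ℝ) (𝓝[>] 0)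
          (𝓝 ⟪f2 σ, D.A x⟫_ℝ) := tendsto_const_nhds.inner (D.A_gen x)
      have t2 : Tendsto (fun t : ℝ => ⟪t⁻¹ • (f2 (σ + t) - f2 σ), (x : H)⟫_ℝ) (𝓝[>] 0)
          (𝓝 ⟪ε⁻¹ • (f1 (σ + ε) - f1 σ), (x : H)⟫_ℝ) :=
        ((d2 σ).tendsto_slope_zero_right).inner tendsto_const_nhds
      refine tendsto_nhds_unique t2 (t1.congr' ?_)
      filter_upwards [self_mem_nhdsWithin] with t ht
      rw [← h2.flow σ t hσ (le_of_lt ht), real_inner_smul_left, real_inner_smul_right,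
        inner_sub_left, inner_sub_right, ContinuousLinearMap.adjoint_inner_left]
    have hd : f2 σ ∈ D.A.adjoint.domain := D.A.mem_adjoint_domain_of_exists _ ⟨_, key⟩
    exact D.A.adjoint.mem_graph_iff.2
      ⟨⟨_, hd⟩, rfl, LinearPMap.adjoint_apply_eq D.A_dense _ key⟩

/-- A `C¹` curve in `D(A*)` solving `k' = -A* k` up to time `b`, so that the functions
`e^{i⟨x, k(t)⟩}` are transported by the drift `A x`. -/
structure Transport (b : ℝ) (k : ℝ → H) : Prop where
  contDiff : ContDiff ℝ 1 k
  dual : ∃ g : ℝ → H, ContDiff ℝ 1 g ∧ (∀ t ∈ Icc 0 D.T, (k t, g t) ∈ D.A.adjoint.graph) ∧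
    ∀ t < b, deriv k t = -g t
  flow : ∀ t r, t ≤ r → r ≤ b → k t = adjoint (D.S (r - t)) (k r)

variable {D}

theorem Transport.mono {b b' : ℝ} {k : ℝ → H} (h : D.Transport b k) (hb : b' ≤ b) :
    D.Transport b' k := by
  obtain ⟨g, h1, h2, h3⟩ := h.dual
  exact ⟨h.contDiff, ⟨g, h1, h2, fun t ht => h3 t (ht.trans_le hb)⟩,
    fun t r ht hr => h.flow t r ht (hr.trans hb)⟩

theorem Transport.neg {b : ℝ} {k : ℝ → H} (h : D.Transport b k) :
    D.Transport b (-k) := by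
  obtain ⟨g, h1, h2, h3⟩ := h.dual
  refine ⟨h.contDiff.neg, ⟨-g, h1.neg, fun t ht => D.A.adjoint.graph.neg_mem (h2 t ht),
    fun t ht => ?_⟩, fun t r ht hr => ?_⟩
  · rw [deriv.neg, h3 t ht]; rfl
  · simp [h.flow t r ht hr]

theorem Transport.add {b : ℝ} {k k' : ℝ → H} (h : D.Transport b k) (h' : D.Transport b k') :
    D.Transport b (k + k') := by
  obtain ⟨g, h1, h2, h3⟩ := h.dual
  obtain ⟨g', h1', h2', h3'⟩ := h'.dual
  refine ⟨h.contDiff.add h'.contDiff, ⟨g + g', h1.add h1',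
    fun t ht => D.A.adjoint.graph.add_mem (h2 t ht) (h2' t ht),
    fun t ht => ?_⟩, fun t r ht hr => ?_⟩
  · rw [deriv_add (h.contDiff.differentiable one_ne_zero t)
      (h'.contDiff.differentiable one_ne_zero t), h3 t ht, h3' t ht, Pi.add_apply, neg_add]
  · simp [h.flow t r ht hr, h'.flow t r ht hr]

variable (D)

theorem exists_transport (κ : H) (b : ℝ) {δ : ℝ} (hδ : 0 < δ) :
    ∃ k : ℝ → H, D.Transport b k ∧ ∀ t ∈ Icc (b - 2 * δ) b, ∀ (x : H) (θ : ℝ),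
      (∀ r ∈ Icc 0 (6 * δ), |⟪κ, D.S r x - x⟫_ℝ| ≤ θ) → |⟪k t - κ, x⟫_ℝ| ≤ θ := by
  obtain ⟨f, f', hf, hf1, hf1', hd, hg⟩ := D.exists_smooth_orbit κ hδ
  set m : ℝ → ℝ := fun r => max 0 (min 1 ((b + δ - r) / δ)) with hm
  have hmc : Continuous m := by fun_prop
  have hmi : ∀ a c, IntervalIntegrable m volume a c := fun a c => hmc.intervalIntegrable a c
  set η : ℝ → ℝ := fun t => ∫ r in t..b + δ, m r with hη
  have hηd : ∀ t, HasDerivAt η (-m t) t := fun t =>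
    intervalIntegral.integral_hasDerivAt_left (hmi _ _)
      hmc.stronglyMeasurable.stronglyMeasurableAtFilter hmc.continuousAt
  have hηc : ContDiff ℝ 1 η := contDiff_one_of_hasDerivAt hηd hmc.neg
  have hm0 : ∀ r, 0 ≤ m r := fun r => le_max_left _ _
  have hm1 : ∀ r, m r ≤ 1 := fun r => max_le zero_le_one (min_le_left _ _)
  have hmb : ∀ r ≤ b, m r = 1 := fun r hr => by
    have : 1 ≤ (b + δ - r) / δ := by rw [le_div_iff₀ hδ]; linarith
    simp [hm, min_eq_left this]
  have hη0 : ∀ t, 0 ≤ η t := fun t => by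
    rcases le_total t (b + δ) with h | h
    · exact intervalIntegral.integral_nonneg h fun r _ => hm0 r
    · have : η t = ∫ r in t..b + δ, (0 : ℝ) := by
        refine intervalIntegral.integral_congr fun r hr => ?_
        rw [uIcc_of_ge h] at hr
        have : (b + δ - r) / δ ≤ 0 := div_nonpos_of_nonpos_of_nonneg (by linarith [hr.1]) hδ.le
        exact max_eq_left ((min_le_right _ _).trans this)
      simp [this]
  have hηflow : ∀ t r, t ≤ r → r ≤ b → η t = η r + (r - t) := fun t r ht hr => by
    have : (∫ q in t..r, m q) = ∫ q in t..r, (1 : ℝ) := by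
      refine intervalIntegral.integral_congr fun q hq => ?_
      rw [uIcc_of_le ht] at hq
      exact hmb q (hq.2.trans hr)
    rw [hη]
    simp only
    rw [← intervalIntegral.integral_add_adjacent_intervals (hmi t r) (hmi r (b + δ)), this]
    simp [add_comm]
  have hkd : ∀ t, HasDerivAt (fun t => f (η t)) (-m t • f' (η t)) t := fun t =>
    HasDerivAt.scomp t (hd (η t)) (hηd t)
  refine ⟨fun t => f (η t), ⟨hf1.comp hηc, ⟨fun t => f' (η t), hf1'.comp hηc,
    fun t _ => hg _ (hη0 t), fun t ht => ?_⟩, fun t r ht hr => ?_⟩, fun t ht x θ h => ?_⟩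
  · rw [(hkd t).deriv, hmb t ht.le, neg_one_smul]
  · rw [hf.flow _ _ (hη0 r) (sub_nonneg.2 ht), hηflow t r ht hr]
  · refine hf.near _ (hη0 t) x θ fun r hr => h r ⟨(hη0 t).trans hr.1, hr.2.trans ?_⟩
    have h1 : η t ≤ b + δ - t := by
      have : η t ≤ ∫ r in t..b + δ, (1 : ℝ) :=
        intervalIntegral.integral_mono_on (by linarith [ht.2]) (hmi _ _) (by simp)
          fun r _ => hm1 r
      simpa using this
    linarith [ht.1]

end FPData

end AdjointOrbits
section Generator

variable {H : Type} [NormedAddCommGroup H] [InnerProductSpace ℝ H] [CompleteSpace H]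
  [SecondCountableTopology H] [MeasurableSpace H] [BorelSpace H]

/-- The real plane wave `Re (z e^{iy})`. -/
noncomputable def wave (z : ℂ) (y : ℝ) : ℝ := (z * Complex.exp (y * Complex.I)).re

theorem wave_eq (z : ℂ) (y : ℝ) : wave z y = z.re * Real.cos y - z.im * Real.sin y := by
  simp [wave, Complex.exp_ofReal_mul_I_re, Complex.exp_ofReal_mul_I_im]

theorem hasDerivAt_wave {c : ℝ → ℂ} {c' : ℂ} {y : ℝ → ℝ} {y' t : ℝ} (hc : HasDerivAt c c' t)
    (hy : HasDerivAt y y' t) :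
    HasDerivAt (fun r => wave (c r) (y r))
      (wave c' (y t) + y' * wave (Complex.I * c t) (y t)) t := by
  have h1 : HasDerivAt (fun r => (c r).re) c'.re t :=
    Complex.reCLM.hasFDerivAt.comp_hasDerivAt t hc
  have h2 : HasDerivAt (fun r => (c r).im) c'.im t :=
    Complex.imCLM.hasFDerivAt.comp_hasDerivAt t hc
  simp only [wave_eq]
  refine ((h1.mul hy.cos).sub (h2.mul hy.sin)).congr_deriv ?_
  rw [Complex.I_mul_re, Complex.I_mul_im]
  ring

theorem hasGradientAt_wave (z : ℂ) (h x : H) :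
    HasGradientAt (fun x => wave z ⟪x, h⟫_ℝ) (wave (Complex.I * z) ⟪x, h⟫_ℝ • h) x := by
  have h1 : HasDerivAt (wave z) (wave (Complex.I * z) ⟪x, h⟫_ℝ) ⟪x, h⟫_ℝ := by
    have := hasDerivAt_wave (hasDerivAt_const ⟪x, h⟫_ℝ z) (hasDerivAt_id ⟪x, h⟫_ℝ)
    rwa [show wave 0 (id ⟪x, h⟫_ℝ) = 0 by simp [wave], zero_add, one_mul] at this
  have h2 : HasFDerivAt (fun x : H => ⟪x, h⟫_ℝ) (innerSL ℝ h) x := by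
    simpa [real_inner_comm] using (innerSL ℝ h).hasFDerivAt (x := x)
  rw [hasGradientAt_iff_hasFDerivAt]
  have h3 := h1.comp_hasFDerivAt x h2
  rw [map_smul]
  exact h3

namespace FPData

variable (D : FPData H)

theorem inner_sqrtC_sqrtC (x y : H) : ⟪D.sqrtC x, D.sqrtC y⟫_ℝ = ⟪D.C x, y⟫_ℝ := by
  rw [← D.sqrtC_sq, ContinuousLinearMap.comp_apply]
  exact (D.sqrtC_pos.isSymmetric (D.sqrtC x) y).symm

theorem hasSum_inner_sqrtC (h : H) :
    HasSum (fun i => ⟪D.sqrtC (D.basis i), h⟫_ℝ * ⟪D.sqrtC (D.basis i), h⟫_ℝ) ⟪D.C h, h⟫_ℝ := by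
  have := D.basis.hasSum_inner_mul_inner (D.sqrtC h) (D.sqrtC h)
  rw [inner_sqrtC_sqrtC] at this
  refine this.congr_fun fun i => ?_
  rw [real_inner_comm (D.basis i) (D.sqrtC h),
    show ⟪D.sqrtC (D.basis i), h⟫_ℝ = ⟪D.basis i, D.sqrtC h⟫_ℝ from D.sqrtC_pos.isSymmetric _ _]

/-- The Kolmogorov operator applied to a plane wave. -/
theorem Lzero_wave {c : ℝ → ℂ} {h g : ℝ → H} {t : ℝ} (hc : DifferentiableAt ℝ c t)
    (hh : DifferentiableAt ℝ h t) (hg : (h t, g t) ∈ D.A.adjoint.graph) (x : H) :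
    D.Lzero (fun p => wave (c p.1) ⟪p.2, h p.1⟫_ℝ) (t, x) =
      wave (deriv c t) ⟪x, h t⟫_ℝ - 1 / 2 * ⟪D.C (h t), h t⟫_ℝ * wave (c t) ⟪x, h t⟫_ℝ +
      (⟪x, deriv h t⟫_ℝ + ⟪x, g t⟫_ℝ + ⟪D.F (t, x), h t⟫_ℝ) *
        wave (Complex.I * c t) ⟪x, h t⟫_ℝ := by
  have hgrad : (gradient fun z => wave (c t) ⟪z, h t⟫_ℝ) =
      fun z => wave (Complex.I * c t) ⟪z, h t⟫_ℝ • h t :=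
    funext fun z => (hasGradientAt_wave _ _ z).gradient
  have hx : xGrad (fun p : ℝ × H => wave (c p.1) ⟪p.2, h p.1⟫_ℝ) (t, x) =
      wave (Complex.I * c t) ⟪x, h t⟫_ℝ • h t := congrFun hgrad x
  have ht : deriv (fun r => wave (c r) ⟪x, h r⟫_ℝ) t =
      wave (deriv c t) ⟪x, h t⟫_ℝ + ⟪x, deriv h t⟫_ℝ * wave (Complex.I * c t) ⟪x, h t⟫_ℝ := by
    have : HasDerivAt (fun r => ⟪x, h r⟫_ℝ) ⟪x, deriv h t⟫_ℝ t := by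
      simpa using (hasDerivAt_const t x).inner ℝ hh.hasDerivAt
    exact (hasDerivAt_wave hc.hasDerivAt this).deriv
  have htr : D.traceCD2 (fun p : ℝ × H => wave (c p.1) ⟪p.2, h p.1⟫_ℝ) (t, x) =
      -(⟪D.C (h t), h t⟫_ℝ * wave (c t) ⟪x, h t⟫_ℝ) := by
    have hf : HasFDerivAt (fun z => wave (Complex.I * c t) ⟪z, h t⟫_ℝ • h t)
        ((InnerProductSpace.toDual ℝ H
          (wave (Complex.I * (Complex.I * c t)) ⟪x, h t⟫_ℝ • h t)).smulRight (h t)) x :=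
      (hasGradientAt_wave _ _ x).hasFDerivAt.smul_const (h t)
    simp only [traceCD2, hgrad, hf.fderiv]
    rw [← mul_neg, ← ((D.hasSum_inner_sqrtC (h t)).mul_right _).tsum_eq]
    congr 1
    funext i
    have : wave (Complex.I * (Complex.I * c t)) ⟪x, h t⟫_ℝ = - wave (c t) ⟪x, h t⟫_ℝ := by
      rw [← mul_assoc, Complex.I_mul_I]; simp [wave]
    simp [this, inner_smul_left, real_inner_comm]
    ring
  have hmem := D.A.adjoint.graph.smul_mem (wave (Complex.I * c t) ⟪x, h t⟫_ℝ) hg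
  have hA : ∀ hk : wave (Complex.I * c t) ⟪x, h t⟫_ℝ • h t ∈ D.A.adjoint.domain,
      D.A.adjoint ⟨_, hk⟩ = wave (Complex.I * c t) ⟪x, h t⟫_ℝ • g t := fun hk => by
    obtain ⟨y, hy1, hy2⟩ := D.A.adjoint.mem_graph_iff.1 hmem
    have : y = ⟨_, hk⟩ := Subtype.ext hy1
    rw [← this]; exact hy2
  have hdom : wave (Complex.I * c t) ⟪x, h t⟫_ℝ • h t ∈ D.A.adjoint.domain := by
    obtain ⟨y, hy1, hy2⟩ := D.A.adjoint.mem_graph_iff.1 hmem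
    have := y.2
    rwa [hy1] at this
  simp only [Lzero, Vzero, hx, htr, dif_pos hdom, hA, ht]
  simp only [inner_smul_right]
  ring

end FPData

end Generator
section Modes

open ProbabilityTheory
open Complex (I)

variable {H : Type} [NormedAddCommGroup H] [InnerProductSpace ℝ H] [CompleteSpace H]
  [SecondCountableTopology H] [MeasurableSpace H] [BorelSpace H]

namespace FPData

variable (D : FPData H)

/-- A transported exponential mode `c(t) e^{i⟨x, k(t)⟩}` with `C¹` amplitude vanishing after the
lifetime `b` of its frequency. -/
structure Mode where
  c : ℝ → ℂ
  k : ℝ → H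
  b : ℝ
  b_le : b ≤ D.T
  contDiff : ContDiff ℝ 1 c
  vanish : ∀ t, b ≤ t → c t = 0
  transport : D.Transport b k

variable {D}

namespace Mode

variable (m : D.Mode)

theorem continuous_k : Continuous m.k := m.transport.contDiff.continuous

theorem continuous_c : Continuous m.c := m.contDiff.continuous

theorem hasDerivAt_c (t : ℝ) : HasDerivAt m.c (deriv m.c t) t :=
  (m.contDiff.differentiable one_ne_zero t).hasDerivAt

theorem continuous_deriv : Continuous (deriv m.c) := m.contDiff.continuous_deriv le_rfl

/-- The plane wave `e^{i⟨x, k(t)⟩}`. -/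
noncomputable def ex (p : ℝ × H) : ℂ := Complex.exp (⟪p.2, m.k p.1⟫_ℝ * I)

theorem norm_ex (p : ℝ × H) : ‖m.ex p‖ = 1 := Complex.norm_exp_ofReal_mul_I _

theorem continuous_ex : Continuous m.ex := by
  have := m.continuous_k
  unfold ex
  fun_prop

/-- The value `c(t) e^{i⟨x, k(t)⟩}`. -/
noncomputable def pt (p : ℝ × H) : ℂ := m.c p.1 * m.ex p

/-- The amplitude of the Ornstein–Uhlenbeck operator applied to the mode. -/
noncomputable def evol (t : ℝ) : ℂ :=
  deriv m.c t - 1 / 2 * (⟪D.C (m.k t), m.k t⟫_ℝ : ℂ) * m.c t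

theorem continuous_evol : Continuous m.evol := by
  have h1 := m.continuous_k
  have h2 := m.continuous_c
  have h3 := m.continuous_deriv
  unfold evol
  fun_prop

/-- The Kolmogorov operator applied to the mode. -/
noncomputable def gen (p : ℝ × H) : ℂ :=
  (m.evol p.1 + I * (⟪D.F p, m.k p.1⟫_ℝ : ℂ) * m.c p.1) * m.ex p

theorem Lzero_re {t : ℝ} (ht : t ∈ Icc 0 D.T) (x : H) :
    D.Lzero (fun p => (m.pt p).re) (t, x) = (m.gen (t, x)).re := by
  obtain ⟨g, _, hg, hkg⟩ := m.transport.dual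
  have h1 := D.Lzero_wave (m.hasDerivAt_c t).differentiableAt
    (m.transport.contDiff.differentiable one_ne_zero t) (hg t ht) x
  have h2 : (⟪x, deriv m.k t⟫_ℝ + ⟪x, g t⟫_ℝ) * wave (I * m.c t) ⟪x, m.k t⟫_ℝ = 0 := by
    rcases lt_or_ge t m.b with h | h
    · simp [hkg t h]
    · simp [m.vanish t h, wave]
  refine h1.trans ?_
  rw [add_mul, h2, zero_add]
  simp only [wave, gen, evol, ex]
  rw [← Complex.re_ofReal_mul, ← Complex.re_ofReal_mul, ← Complex.sub_re, ← Complex.add_re]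
  congr 1
  push_cast
  ring

theorem re_pt_mem_EA : (fun p => (m.pt p).re) ∈ D.EA := by
  obtain ⟨g, hg1, hg, hkg⟩ := m.transport.dual
  have hk : D.CinDAstar m.k g := ⟨m.transport.contDiff.contDiffOn, hg1.contDiffOn, hg⟩
  have e : (fun p => (m.pt p).re) = (fun p : ℝ × H => (m.c p.1).re * Real.cos ⟪p.2, m.k p.1⟫_ℝ) +
      fun p : ℝ × H => -(m.c p.1).im * Real.sin ⟪p.2, m.k p.1⟫_ℝ := by
    funext p
    have := wave_eq (m.c p.1) ⟪p.2, m.k p.1⟫_ℝ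
    simp only [wave] at this
    simp [pt, ex, this, sub_eq_add_neg]
  have h0 : m.c D.T = 0 := m.vanish _ m.b_le
  rw [e]
  refine Submodule.add_mem _ (Submodule.subset_span ?_) (Submodule.subset_span ?_)
  · exact ⟨_, _, _, (Complex.reCLM.contDiff.comp m.contDiff).contDiffOn, by simp [h0], hk, .inl rfl⟩
  · exact ⟨_, _, _, (Complex.imCLM.contDiff.comp m.contDiff).neg.contDiffOn, by simp [h0], hk,
      .inr rfl⟩

theorem exists_norm_le : ∃ B, ∀ t ∈ Icc 0 D.T, ‖m.c t‖ ≤ B ∧ ‖m.evol t‖ ≤ B ∧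
    ‖m.c t‖ * ‖m.k t‖ ≤ B := by
  obtain ⟨B1, h1⟩ := (isCompact_Icc (a := 0) (b := D.T)).exists_bound_of_continuousOn
    m.continuous_c.continuousOn
  obtain ⟨B2, h2⟩ := (isCompact_Icc (a := 0) (b := D.T)).exists_bound_of_continuousOn
    m.continuous_evol.continuousOn
  obtain ⟨B3, h3⟩ := (isCompact_Icc (a := 0) (b := D.T)).exists_bound_of_continuousOn
    (m.continuous_c.norm.mul m.continuous_k.norm).continuousOn
  refine ⟨max B1 (max B2 B3), fun t ht => ⟨(h1 t ht).trans (le_max_left _ _),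
    (h2 t ht).trans ((le_max_left _ _).trans (le_max_right _ _)), (le_abs_self _).trans
    ((h3 t ht).trans ((le_max_right _ _).trans (le_max_right _ _)))⟩⟩

theorem measurable_gen : Measurable m.gen := by
  have h1 := m.continuous_k
  have h2 := m.continuous_c
  have h3 := m.continuous_evol
  have h4 := m.continuous_ex
  have h5 := D.F_meas
  unfold gen
  refine Measurable.mul (Measurable.add ?_ (Measurable.mul (Measurable.mul ?_ ?_) ?_)) h4.measurable
  · exact (h3.comp continuous_fst).measurable
  · exact measurable_const
  · exact Complex.measurable_ofReal.comp (h5.inner (h1.comp continuous_fst).measurable)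
  · exact (h2.comp continuous_fst).measurable

theorem continuous_pt : Continuous m.pt := by
  have h2 := m.continuous_c
  have h4 := m.continuous_ex
  unfold pt
  fun_prop

theorem norm_pt (p : ℝ × H) : ‖m.pt p‖ = ‖m.c p.1‖ := by simp [pt, norm_ex]

theorem norm_gen_le {B : ℝ} {p : ℝ × H} (hB : ‖m.evol p.1‖ ≤ B ∧ ‖m.c p.1‖ * ‖m.k p.1‖ ≤ B) :
    ‖m.gen p‖ ≤ B * (1 + ‖D.F p‖) := by
  rw [gen, norm_mul, norm_ex, mul_one]
  refine (norm_add_le _ _).trans ?_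
  rw [norm_mul, norm_mul, Complex.norm_I, one_mul, Complex.norm_real]
  have h1 : ‖⟪D.F p, m.k p.1⟫_ℝ‖ * ‖m.c p.1‖ ≤ ‖D.F p‖ * (‖m.c p.1‖ * ‖m.k p.1‖) := by
    have := mul_le_mul_of_nonneg_right (norm_inner_le_norm (𝕜 := ℝ) (D.F p) (m.k p.1))
      (norm_nonneg (m.c p.1))
    linarith
  have h2 := mul_le_mul_of_nonneg_left hB.2 (norm_nonneg (D.F p))
  linarith [hB.1]

theorem integrable_gen {ν : Measure (ℝ × H)} [IsFiniteMeasure ν] (hF : MemLp D.F 2 ν)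
    (hν : ∀ᵐ p ∂ν, p.1 ∈ Icc 0 D.T) : Integrable m.gen ν := by
  obtain ⟨B, hB⟩ := m.exists_norm_le
  have hi : Integrable (fun p => B * (1 + ‖D.F p‖)) ν :=
    ((integrable_const 1).add (hF.integrable one_le_two).norm).const_mul B
  refine hi.mono' m.measurable_gen.aestronglyMeasurable ?_
  filter_upwards [hν] with p hp
  exact m.norm_gen_le (hB _ hp).2

end Mode

variable (D)

/-- A weak solution of the Fokker–Planck equation tested against transported modes. -/
structure WeakSol (s : ℝ) (ζ : Measure H) (ν : Measure (ℝ × H)) : Prop where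
  finite : IsFiniteMeasure ν
  time : ∀ᵐ p ∂ν, p.1 ∈ Ico 0 D.T
  memLp : MemLp D.F 2 ν
  identity : ∀ m : D.Mode, ∫ p, (m.gen p).re ∂ν = -∫ y, (m.pt (s, y)).re ∂ζ

variable {D}

theorem weakSol_of_isFPSol {s : ℝ} (hs : s ∈ Icc 0 D.T) {ζ : Measure H} [IsProbabilityMeasure ζ]
    {μ : Measure (ℝ × H)} {μt : ℝ → Measure H} (hμ : D.IsFPSol s ζ μ μt)
    (h2 : D.moment2 s μt) : D.WeakSol s ζ μ := by
  obtain ⟨hprob, ⟨hmeas, hker⟩, -, hid⟩ := hμ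
  let κ : Kernel ℝ H := ⟨fun t => if t ∈ Icc s D.T then μt t else 0,
    Measurable.ite measurableSet_Icc (Measure.measurable_of_measurable_coe _ hmeas)
      measurable_const⟩
  have hκ : ∀ t ∈ Icc s D.T, κ t = μt t := fun t ht => if_pos ht
  have : IsFiniteKernel κ := ⟨1, ENNReal.one_lt_top, fun t => by
    by_cases ht : t ∈ Icc s D.T
    · rw [hκ t ht]; have := hprob t ht; exact prob_le_one
    · rw [show κ t = 0 from if_neg ht]; simp⟩
  set τ : Measure ℝ := volume.restrict (Icc s D.T) with hτ
  have hτmem : ∀ᵐ t ∂τ, t ∈ Icc s D.T := ae_restrict_mem measurableSet_Icc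
  have hμκ : μ = τ ⊗ₘ κ := by
    ext E hE
    rw [hker E hE, Measure.compProd_apply hE]
    refine lintegral_congr_ae ?_
    filter_upwards [hτmem] with t ht
    rw [hκ t ht]; rfl
  have hfin : IsFiniteMeasure μ := by rw [hμκ]; infer_instance
  have hFn : Measurable D.FnormE :=
    Measurable.ite D.DF_meas D.F_meas.nnnorm.coe_nnreal_ennreal measurable_const
  have hF2 : ∫⁻ p, D.FnormE p ^ 2 ∂μ < ⊤ := by
    rw [hμκ, Measure.lintegral_compProd (hFn.pow_const 2)]
    refine lt_of_le_of_lt ?_ h2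
    refine lintegral_mono_ae ?_
    filter_upwards [hτmem] with t ht
    rw [hκ t ht]
    refine lintegral_mono fun y => ?_
    exact (le_add_left le_rfl).trans (le_add_right le_rfl)
  have hmem : MemLp D.F 2 μ := by
    refine ⟨D.F_meas.aestronglyMeasurable, ?_⟩
    rw [eLpNorm_lt_top_iff_lintegral_rpow_enorm_lt_top two_ne_zero ENNReal.ofNat_ne_top]
    refine lt_of_le_of_lt (lintegral_mono fun p => ?_) hF2
    simp only [ENNReal.toReal_ofNat, ENNReal.rpow_ofNat]
    gcongr
    unfold FnormE
    split_ifs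
    · exact le_rfl
    · exact le_top
  have htime : ∀ᵐ p ∂μ, p.1 ∈ Icc s D.T ∧ p.1 ≠ D.T := by
    have hS : MeasurableSet {p : ℝ × H | p.1 ∈ Icc s D.T ∧ p.1 ≠ D.T} :=
      (measurable_fst measurableSet_Icc).inter
        (measurable_fst (measurableSet_singleton D.T).compl)
    rw [hμκ, Measure.ae_compProd_iff hS]
    have h3 : ∀ᵐ t ∂τ, t ≠ D.T := ae_restrict_of_ae (by simp [ae_iff])
    filter_upwards [hτmem, h3] with t ht ht' using .of_forall fun _ => ⟨ht, ht'⟩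
  refine ⟨hfin, htime.mono fun p hp => ⟨hs.1.trans hp.1.1, lt_of_le_of_ne hp.1.2 hp.2⟩, hmem,
    fun m => ?_⟩
  have hsub : ∀ t ∈ Icc s D.T, t ∈ Icc 0 D.T := fun t ht => ⟨hs.1.trans ht.1, ht.2⟩
  have hgint : Integrable (fun p => (m.gen p).re) μ :=
    (m.integrable_gen hmem (htime.mono fun p hp => hsub _ hp.1)).re
  set G : ℝ → ℝ := fun r => ∫ y, D.Lzero (fun p => (m.pt p).re) (r, y) ∂(μt r) with hG
  have hGae : ∀ t ∈ Icc s D.T, ∫ y, (m.gen (t, y)).re ∂(κ t) = G t := fun t ht => by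
    simp only [hG, hκ t ht, m.Lzero_re (hsub t ht)]
  have hGae' : (fun t => ∫ y, (m.gen (t, y)).re ∂(κ t)) =ᵐ[τ] G := hτmem.mono hGae
  have hGint : IntegrableOn G (Icc s D.T) := by
    rw [hμκ] at hgint
    exact (integrable_congr hGae').1 (MeasureTheory.Integrable.integral_compProd
      (κ := Kernel.const Unit τ) (η := Kernel.prodMkLeft Unit κ) (a := ()) hgint)
  have htot : ∫ p, (m.gen p).re ∂μ = ∫ t in Icc s D.T, G t := by
    rw [hμκ] at hgint ⊢
    rw [Measure.integral_compProd hgint]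
    exact integral_congr_ae hGae'
  have key := hid _ m.re_pt_mem_EA
  rcases hs.2.eq_or_lt with hsT | hsT
  · rw [htot, hsT]
    have h0 : m.c D.T = 0 := m.vanish _ m.b_le
    simp [Mode.pt, h0]
  rw [htot]
  have l1 : Tendsto (fun t => ∫ y, (m.pt (t, y)).re ∂(μt t)) (𝓝[<] D.T) (𝓝 0) := by
    have hc : Tendsto (fun t => ‖m.c t‖) (𝓝[<] D.T) (𝓝 0) := by
      have := (m.continuous_c.norm.tendsto D.T).mono_left (nhdsWithin_le_nhds (s := Iio D.T))
      simpa [m.vanish _ m.b_le] using this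
    refine squeeze_zero_norm' ?_ hc
    filter_upwards [Ioo_mem_nhdsLT hsT] with t ht
    have := hprob t ⟨ht.1.le, ht.2.le⟩
    have h5 := norm_integral_le_of_norm_le_const (μ := μt t) (C := ‖m.c t‖)
      (f := fun y => (m.pt (t, y)).re) (.of_forall fun y =>
        (Complex.abs_re_le_norm _).trans (m.norm_pt (t, y)).le)
    simpa using h5
  have l2 : Tendsto (fun t => ∫ y, (m.pt (s, y)).re ∂ζ + ∫ r in Icc s t, G r) (𝓝[<] D.T)
      (𝓝 (∫ y, (m.pt (s, y)).re ∂ζ + ∫ r in Icc s D.T, G r)) := by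
    have h6 := intervalIntegral.continuousOn_primitive_Icc hGint
    have h7 := (h6 D.T (right_mem_Icc.2 hsT.le)).mono_left
      (nhdsWithin_mono D.T (Ioo_subset_Icc_self (a := s) (b := D.T)))
    rw [nhdsWithin_Ioo_eq_nhdsLT hsT] at h7
    exact tendsto_const_nhds.add h7
  have h8 : ∃ᶠ t in 𝓝[<] D.T, ∫ y, (m.pt (t, y)).re ∂(μt t) =
      ∫ y, (m.pt (s, y)).re ∂ζ + ∫ r in Icc s t, G r := by
    intro hne
    obtain ⟨a, ha, hane⟩ := (mem_nhdsLT_iff_exists_Ioo_subset' hsT).1 hne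
    rw [ae_iff, Measure.restrict_apply' measurableSet_Icc] at key
    have h9 : volume (Ioo (max a s) D.T) ≤ 0 := by
      rw [← key]
      exact measure_mono fun t ht => ⟨hane ⟨(le_max_left _ _).trans_lt ht.1, ht.2⟩,
        ⟨((le_max_right _ _).trans_lt ht.1).le, ht.2.le⟩⟩
    rw [Real.volume_Ioo, nonpos_iff_eq_zero, ENNReal.ofReal_eq_zero] at h9
    have : max a s < D.T := max_lt ha hsT
    linarith
  have h10 := tendsto_nhds_unique_of_frequently_eq l1 l2 h8
  linarith

end FPData

end Modes
section Energy

open Complex (I)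
open scoped ComplexConjugate

variable {H : Type} [NormedAddCommGroup H] [InnerProductSpace ℝ H] [CompleteSpace H]
  [SecondCountableTopology H] [MeasurableSpace H] [BorelSpace H]

namespace FPData

variable {D : FPData H}

theorem inner_C_comm (x y : H) : ⟪D.C x, y⟫_ℝ = ⟪D.C y, x⟫_ℝ := by
  rw [show ⟪D.C x, y⟫_ℝ = ⟪x, D.C y⟫_ℝ from D.C_pos.isSymmetric x y, real_inner_comm]

namespace Mode

variable (m m' : D.Mode)

/-- Half the product of two modes. -/
noncomputable def mul : D.Mode where
  c t := 1 / 2 * (m.c t * m'.c t)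
  k := m.k + m'.k
  b := min m.b m'.b
  b_le := (min_le_left _ _).trans m.b_le
  contDiff := contDiff_const.mul (m.contDiff.mul m'.contDiff)
  vanish t ht := by
    rcases min_le_iff.1 ht with h | h
    · simp [m.vanish t h]
    · simp [m'.vanish t h]
  transport := (m.transport.mono (min_le_left _ _)).add (m'.transport.mono (min_le_right _ _))

/-- The complex conjugate of a mode. -/
noncomputable def star : D.Mode where
  c t := conj (m.c t)
  k := -m.k
  b := m.b
  b_le := m.b_le
  contDiff := Complex.conjCLE.contDiff.comp m.contDiff
  vanish t ht := by simp [m.vanish t ht]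
  transport := m.transport.neg

theorem ex_mul (p : ℝ × H) : (m.mul m').ex p = m.ex p * m'.ex p := by
  simp [ex, mul, inner_add_right, add_mul, Complex.exp_add]

theorem ex_star (p : ℝ × H) : m.star.ex p = conj (m.ex p) := by
  simp [ex, star, inner_neg_right, ← Complex.exp_conj]

theorem pt_mul (p : ℝ × H) : (m.mul m').pt p = 1 / 2 * (m.pt p * m'.pt p) := by
  rw [pt, ex_mul, pt, pt, mul]
  ring

theorem pt_star (p : ℝ × H) : m.star.pt p = conj (m.pt p) := by
  rw [pt, ex_star, pt, map_mul, star]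

theorem gen_mul (p : ℝ × H) : (m.mul m').gen p = 1 / 2 * (m.gen p * m'.pt p + m.pt p * m'.gen p -
    (⟪D.C (m.k p.1), m'.k p.1⟫_ℝ : ℂ) * (m.pt p * m'.pt p)) := by
  have hd : deriv (m.mul m').c p.1 =
      1 / 2 * (deriv m.c p.1 * m'.c p.1 + m.c p.1 * deriv m'.c p.1) :=
    (((m.hasDerivAt_c p.1).mul (m'.hasDerivAt_c p.1)).const_mul _).deriv
  rw [gen, evol, hd, ex_mul]
  simp only [gen, evol, pt, mul, Pi.add_apply, map_add, inner_add_left, inner_add_right,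
    inner_C_comm (m'.k p.1) (m.k p.1)]
  push_cast
  ring

theorem gen_star (p : ℝ × H) : m.star.gen p = conj (m.gen p) := by
  have hd : deriv m.star.c p.1 = conj (deriv m.c p.1) :=
    (Complex.conjCLE.hasFDerivAt.comp_hasDerivAt p.1 (m.hasDerivAt_c p.1)).deriv
  rw [gen, evol, hd, ex_star]
  simp [gen, evol, star, Complex.conj_ofNat]

theorem re_gen_mul_add (p : ℝ × H) :
    ((m.mul m').gen p).re + ((m.mul m'.star).gen p).re =
      (m.gen p).re * (m'.pt p).re + (m.pt p).re * (m'.gen p).re +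
        ⟪D.C (m.k p.1), m'.k p.1⟫_ℝ * ((m.pt p).im * (m'.pt p).im) := by
  rw [gen_mul, gen_mul, gen_star, pt_star]
  simp [star]
  ring

theorem re_pt_mul_add (p : ℝ × H) :
    ((m.mul m').pt p).re + ((m.mul m'.star).pt p).re = (m.pt p).re * (m'.pt p).re := by
  rw [pt_mul, pt_mul, pt_star]
  simp
  ring

end Mode

variable {ι : Type} [Fintype ι]

/-- The real function represented by a family of modes. -/
noncomputable def fval (u : ι → D.Mode) (p : ℝ × H) : ℝ := ∑ i, ((u i).pt p).re

/-- The Kolmogorov operator applied to `fval u`. -/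
noncomputable def fgen (u : ι → D.Mode) (p : ℝ × H) : ℝ := ∑ i, ((u i).gen p).re

/-- The spatial gradient of `fval u`. -/
noncomputable def fgrad (u : ι → D.Mode) (p : ℝ × H) : H := ∑ i, (-((u i).pt p).im) • (u i).k p.1

theorem continuous_fgrad (u : ι → D.Mode) : Continuous (fgrad u) := by
  unfold fgrad
  refine continuous_finsetSum _ fun i _ => ?_
  exact (Complex.continuous_im.comp (u i).continuous_pt).neg.smul
    ((u i).continuous_k.comp continuous_fst)

theorem exists_norm_fgrad_le (u : ι → D.Mode) : ∃ B, ∀ p : ℝ × H, p.1 ∈ Icc 0 D.T →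
    ‖fgrad u p‖ ≤ B := by
  choose B hB using fun i => (u i).exists_norm_le
  refine ⟨∑ i, B i, fun p hp => norm_sum_le_of_le _ fun i _ => ?_⟩
  rw [norm_smul, norm_neg]
  refine le_trans ?_ (hB i _ hp).2.2
  gcongr
  exact (Complex.abs_im_le_norm _).trans ((u i).norm_pt p).le

theorem WeakSol.ae_mem_Icc {s : ℝ} {ζ : Measure H} {ν : Measure (ℝ × H)} (h : D.WeakSol s ζ ν) :
    ∀ᵐ p ∂ν, p.1 ∈ Icc 0 D.T :=
  h.time.mono fun _ hp => Ico_subset_Icc_self hp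

theorem WeakSol.integral_fgen {s : ℝ} {ζ : Measure H} [IsFiniteMeasure ζ] {ν : Measure (ℝ × H)}
    (h : D.WeakSol s ζ ν) (u : ι → D.Mode) :
    ∫ p, fgen u p ∂ν = -∫ y, fval u (s, y) ∂ζ := by
  have := h.finite
  have hi : ∀ m : D.Mode, Integrable (fun y => (m.pt (s, y)).re) ζ := fun m => by
    refine Integrable.re (f := fun y => m.pt (s, y)) ?_
    have hc := m.continuous_pt
    refine Integrable.of_bound (C := ‖m.c s‖) ?_ (.of_forall fun y => (m.norm_pt (s, y)).le)
    exact (by fun_prop : Continuous fun y => m.pt (s, y)).aestronglyMeasurable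
  have hg : ∀ i, Integrable (fun p => ((u i).gen p).re) ν := fun i =>
    ((u i).integrable_gen h.memLp h.ae_mem_Icc).re
  unfold fgen fval
  rw [integral_finsetSum _ fun i _ => hg i,
    integral_finsetSum _ fun i _ => hi (u i), ← Finset.sum_neg_distrib]
  exact Finset.sum_congr rfl fun i _ => h.identity (u i)

/-- The square of a family of modes, as a family of modes. -/
noncomputable def sqFamily (u : ι → D.Mode) : (ι × ι) ⊕ (ι × ι) → D.Mode :=
  Sum.elim (fun ij => (u ij.1).mul (u ij.2)) fun ij => (u ij.1).mul (u ij.2).star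

theorem fval_sqFamily (u : ι → D.Mode) (p : ℝ × H) : fval (sqFamily u) p = fval u p ^ 2 := by
  rw [fval, Fintype.sum_sum_type, ← Finset.sum_add_distrib]
  simp only [sqFamily, Sum.elim_inl, Sum.elim_inr, Mode.re_pt_mul_add]
  rw [Fintype.sum_prod_type, pow_two, fval, Finset.sum_mul_sum]

theorem fgen_sqFamily (u : ι → D.Mode) (p : ℝ × H) :
    fgen (sqFamily u) p = 2 * fval u p * fgen u p + ⟪D.C (fgrad u p), fgrad u p⟫_ℝ := by
  rw [fgen, Fintype.sum_sum_type, ← Finset.sum_add_distrib]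
  simp only [sqFamily, Sum.elim_inl, Sum.elim_inr, Mode.re_gen_mul_add]
  rw [Fintype.sum_prod_type]
  simp only [Finset.sum_add_distrib, fgrad, map_sum, map_smul, sum_inner, inner_sum,
    real_inner_smul_left, real_inner_smul_right]
  simp only [← Finset.sum_mul_sum]
  rw [← fgen, ← fval]
  congr 1
  · ring
  · rw [Finset.sum_comm]
    refine Finset.sum_congr rfl fun i _ => Finset.sum_congr rfl fun j _ => ?_
    rw [inner_C_comm]
    ring

theorem WeakSol.energy {s : ℝ} {ζ : Measure H} [IsFiniteMeasure ζ] {ν : Measure (ℝ × H)}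
    (h : D.WeakSol s ζ ν) (u : ι → D.Mode) :
    ∫ p, (2 * fval u p * fgen u p + ⟪D.C (fgrad u p), fgrad u p⟫_ℝ) ∂ν ≤ 0 := by
  have := h.integral_fgen (sqFamily u)
  simp only [fgen_sqFamily, fval_sqFamily] at this
  rw [this, neg_nonpos]
  exact integral_nonneg fun y => sq_nonneg _

end FPData

end Energy
section MaximumPrinciple

open Complex (I)

variable {H : Type} [NormedAddCommGroup H] [InnerProductSpace ℝ H] [CompleteSpace H]
  [SecondCountableTopology H] [MeasurableSpace H] [BorelSpace H]

theorem trigSum_max {ι : Type} [Fintype ι] {z : ι → ℂ} {y : ι → ℝ}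
    (h : ∀ s : ℝ, ∑ i, wave (z i) (s * y i) ≤ ∑ i, (z i).re) :
    ∑ i, (z i).im * y i = 0 ∧ 0 ≤ ∑ i, (z i).re * y i ^ 2 := by
  have hw : ∀ z : ℂ, wave z 0 = z.re := fun z => by simp [wave]
  have d : ∀ (z : ℂ) (y s : ℝ),
      HasDerivAt (fun s => wave z (s * y)) (y * wave (I * z) (s * y)) s := fun z y s => by
    have := hasDerivAt_wave (hasDerivAt_const s z) ((hasDerivAt_id s).mul_const y)
    simpa [show ∀ y, wave 0 y = 0 by simp [wave]] using this
  set f : ℝ → ℝ := fun s => ∑ i, wave (z i) (s * y i) with hf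
  have d1 : ∀ s, HasDerivAt f (∑ i, y i * wave (I * z i) (s * y i)) s := fun s =>
    HasDerivAt.fun_sum fun i _ => d (z i) (y i) s
  have e1 : deriv f = fun s => ∑ i, y i * wave (I * z i) (s * y i) := funext fun s => (d1 s).deriv
  have d2 : HasDerivAt (deriv f) (-∑ i, (z i).re * y i ^ 2) 0 := by
    rw [e1, ← Finset.sum_neg_distrib]
    refine (HasDerivAt.fun_sum fun i _ => (d (I * z i) (y i) 0).const_mul (y i)).congr_deriv ?_
    refine Finset.sum_congr rfl fun i _ => ?_
    rw [zero_mul, hw]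
    simp
    ring
  have hmax : IsLocalMax f 0 := .of_forall fun s => by
    simpa [hf, hw] using h s
  have h1 : deriv f 0 = 0 := hmax.deriv_eq_zero
  refine ⟨?_, ?_⟩
  · rw [e1] at h1
    simp only [zero_mul, hw, Complex.I_mul_re] at h1
    rw [← neg_eq_zero, ← h1, ← Finset.sum_neg_distrib]
    exact Finset.sum_congr rfl fun i _ => by ring
  · by_contra! hneg
    have hmin : IsLocalMin f 0 := isLocalMin_of_deriv_deriv_pos (by rw [d2.deriv]; linarith) h1
      (d1 0).continuousAt
    have hc : f =ᶠ[𝓝 0] fun _ => f 0 := by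
      filter_upwards [hmax, hmin] with s hs hs' using le_antisymm hs hs'
    have : deriv (deriv f) 0 = 0 := by
      rw [hc.deriv.deriv_eq]
      simp
    rw [d2.deriv] at this
    linarith

/-- Multiplicative functionals on frequency curves, compactifying the points of `H`. -/
def IsChar (θ : (ℝ → H) → Circle) : Prop := ∀ k k', θ (k + k') = θ k * θ k'

/-- The evaluation functional at a space-time point. -/
noncomputable def evalChar (p : ℝ × H) (k : ℝ → H) : Circle := Circle.exp ⟪p.2, k p.1⟫_ℝ

theorem isChar_evalChar (p : ℝ × H) : IsChar (evalChar p) := fun k k' => by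
  simp [evalChar, inner_add_right]

theorem isCompact_isChar : IsCompact {θ : (ℝ → H) → Circle | IsChar θ} := by
  refine IsClosed.isCompact ?_
  simp only [IsChar, ofPred_forall]
  refine isClosed_iInter fun k => isClosed_iInter fun k' => isClosed_eq ?_ ?_ <;> fun_prop

namespace FPData

variable {D : FPData H} {ι : Type} [Fintype ι]

/-- The value of a family of modes at a functional. -/
noncomputable def cval (u : ι → D.Mode) (t : ℝ) (θ : (ℝ → H) → Circle) : ℝ :=
  ∑ i, ((u i).c t * θ (u i).k).re

/-- The Ornstein–Uhlenbeck operator applied to a family of modes, at a functional. -/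
noncomputable def cev (u : ι → D.Mode) (t : ℝ) (θ : (ℝ → H) → Circle) : ℝ :=
  ∑ i, ((u i).evol t * θ (u i).k).re

/-- The gradient of a family of modes at a functional. -/
noncomputable def cgrad (u : ι → D.Mode) (t : ℝ) (θ : (ℝ → H) → Circle) : H :=
  ∑ i, (-((u i).c t * θ (u i).k).im) • (u i).k t

theorem Mode.ex_eq (m : D.Mode) (p : ℝ × H) : m.ex p = evalChar p m.k := by
  simp [ex, evalChar, Circle.coe_exp]

theorem fval_eq (u : ι → D.Mode) (p : ℝ × H) : fval u p = cval u p.1 (evalChar p) := by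
  simp [fval, cval, Mode.pt, Mode.ex_eq]

theorem fgrad_eq (u : ι → D.Mode) (p : ℝ × H) : fgrad u p = cgrad u p.1 (evalChar p) := by
  simp [fgrad, cgrad, Mode.pt, Mode.ex_eq]

theorem fgen_eq (u : ι → D.Mode) (p : ℝ × H) :
    fgen u p = cev u p.1 (evalChar p) + ⟪D.F p, fgrad u p⟫_ℝ := by
  rw [fgen, cev, fgrad, inner_sum, ← Finset.sum_add_distrib]
  refine Finset.sum_congr rfl fun i _ => ?_
  rw [real_inner_smul_right, ← Mode.ex_eq, Mode.gen, add_mul, Complex.add_re, Mode.pt]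
  congr 1
  rw [mul_comm I, mul_assoc, mul_assoc, Complex.re_ofReal_mul, Complex.I_mul_re]
  ring

theorem continuous_cval (u : ι → D.Mode) :
    Continuous fun q : ℝ × ((ℝ → H) → Circle) => cval u q.1 q.2 := by
  unfold cval
  refine continuous_finsetSum _ fun i _ => ?_
  have := (u i).continuous_c
  refine Complex.continuous_re.comp (.mul (this.comp continuous_fst) ?_)
  fun_prop

/-- The maximum principle for backward equations on the compactified space. -/
theorem cval_le_of_le (u : ι → D.Mode) {M : ℝ} (hM : 0 ≤ M) {w : ℝ → ((ℝ → H) → Circle) → H}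
    (h : ∀ t ∈ Icc 0 D.T, ∀ θ, IsChar θ → -M ≤ cev u t θ + ⟪w t θ, cgrad u t θ⟫_ℝ)
    {t : ℝ} (ht : t ∈ Icc 0 D.T) {θ : (ℝ → H) → Circle} (hθ : IsChar θ) :
    cval u t θ ≤ M * D.T := by
  by_contra! hlt
  obtain ⟨ε, hε, hε'⟩ : ∃ ε > 0, (M + ε) * D.T < cval u t θ := by
    refine ⟨(cval u t θ - M * D.T) / (2 * D.T), div_pos (by linarith) (by linarith [D.hT]), ?_⟩
    have := D.hT
    field_simp
    linarith
  have hcont : Continuous fun q : ℝ × ((ℝ → H) → Circle) =>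
      cval u q.1 q.2 - (M + ε) * (D.T - q.1) := (continuous_cval u).sub (by fun_prop)
  obtain ⟨⟨t₀, θ₀⟩, ⟨ht₀, hθ₀⟩, hmax⟩ := (isCompact_Icc.prod isCompact_isChar).exists_isMaxOn
    ⟨(t, θ), ⟨ht, hθ⟩⟩ hcont.continuousOn
  replace hmax : ∀ r ∈ Icc 0 D.T, ∀ η, IsChar η → cval u r η - (M + ε) * (D.T - r) ≤
      cval u t₀ θ₀ - (M + ε) * (D.T - t₀) := fun r hr η hη => hmax (a := (r, η)) ⟨hr, hη⟩
  have hT : t₀ < D.T := by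
    refine lt_of_le_of_ne ht₀.2 fun he => ?_
    have h1 := hmax t ht θ hθ
    have h2 : cval u D.T θ₀ = 0 := Finset.sum_eq_zero fun i _ => by
      simp [(u i).vanish _ (u i).b_le]
    rw [he, h2] at h1
    nlinarith [mul_nonneg (add_nonneg hM hε.le) ht.1]
  have htime : ∑ i, (deriv (u i).c t₀ * θ₀ (u i).k).re + (M + ε) ≤ 0 := by
    have hd : HasDerivAt (fun r => cval u r θ₀ - (M + ε) * (D.T - r))
        (∑ i, (deriv (u i).c t₀ * θ₀ (u i).k).re + (M + ε)) t₀ := by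
      have h1 : HasDerivAt (fun r => cval u r θ₀) (∑ i, (deriv (u i).c t₀ * θ₀ (u i).k).re) t₀ :=
        HasDerivAt.fun_sum fun i _ =>
          Complex.reCLM.hasFDerivAt.comp_hasDerivAt t₀ (((u i).hasDerivAt_c t₀).mul_const _)
      refine (h1.sub (((hasDerivAt_id t₀).const_sub D.T).const_mul (M + ε))).congr_deriv ?_
      ring
    refine le_of_tendsto hd.tendsto_slope_zero_right ?_
    filter_upwards [Ioo_mem_nhdsGT (sub_pos.2 hT)] with r hr
    have := hmax (t₀ + r) ⟨by linarith [ht₀.1, hr.1], by linarith [hr.2]⟩ θ₀ hθ₀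
    exact mul_nonpos_of_nonneg_of_nonpos (inv_nonneg.2 hr.1.le) (by linarith)
  have hspace : ∀ v : H,
      ∑ i, ((u i).c t₀ * θ₀ (u i).k).im * ⟪v, (u i).k t₀⟫_ℝ = 0 ∧
      0 ≤ ∑ i, ((u i).c t₀ * θ₀ (u i).k).re * ⟪v, (u i).k t₀⟫_ℝ ^ 2 := fun v => by
    refine trigSum_max fun s => ?_
    have hs : IsChar fun k => θ₀ k * Circle.exp (s * ⟪v, k t₀⟫_ℝ) := fun k k' => by
      have hkk : θ₀ (k + k') = θ₀ k * θ₀ k' := hθ₀ k k'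
      simp only [Pi.add_apply, inner_add_right, mul_add, Circle.exp_add]
      rw [hkk]
      exact mul_mul_mul_comm (G := Circle) _ _ _ _
    have := hmax t₀ ht₀ _ hs
    simp only [sub_le_sub_iff_right] at this
    refine (Eq.le ?_).trans this
    refine Finset.sum_congr rfl fun i _ => ?_
    simp [wave, Circle.coe_exp, mul_assoc]
  have hgrad : cgrad u t₀ θ₀ = 0 := by
    refine ext_inner_left ℝ fun v => ?_
    rw [cgrad, inner_sum, inner_zero_right, ← neg_eq_zero, ← (hspace v).1,
      ← Finset.sum_neg_distrib]
    refine Finset.sum_congr rfl fun i _ => ?_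
    rw [real_inner_smul_right]
    ring
  have htrace : 0 ≤ ∑ i, ((u i).c t₀ * θ₀ (u i).k).re * ⟪D.C ((u i).k t₀), (u i).k t₀⟫_ℝ := by
    refine (hasSum_sum fun i (_ : i ∈ Finset.univ) =>
      (D.hasSum_inner_sqrtC ((u i).k t₀)).mul_left ((u i).c t₀ * θ₀ (u i).k).re).nonneg fun n => ?_
    simpa only [pow_two] using (hspace (D.sqrtC (D.basis n))).2
  have h3 := h t₀ ht₀ θ₀ hθ₀
  have h4 : cev u t₀ θ₀ = ∑ i, (deriv (u i).c t₀ * θ₀ (u i).k).re -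
      1 / 2 * ∑ i, ((u i).c t₀ * θ₀ (u i).k).re * ⟪D.C ((u i).k t₀), (u i).k t₀⟫_ℝ := by
    rw [cev, Finset.mul_sum, ← Finset.sum_sub_distrib]
    refine Finset.sum_congr rfl fun i _ => ?_
    rw [mul_comm _ ⟪D.C _, _⟫_ℝ, ← Complex.re_ofReal_mul, Mode.evol, sub_mul, Complex.sub_re]
    congr 1
    rw [show (1 / 2 : ℂ) = ((1 / 2 : ℝ) : ℂ) by simp, mul_assoc, mul_assoc,
      Complex.re_ofReal_mul]
  rw [hgrad, inner_zero_right, h4] at h3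
  linarith

/-- The family with opposite amplitudes. -/
noncomputable def negFamily (u : ι → D.Mode) (i : ι) : D.Mode where
  c t := -(u i).c t
  k := (u i).k
  b := (u i).b
  b_le := (u i).b_le
  contDiff := (u i).contDiff.neg
  vanish t ht := by simp [(u i).vanish t ht]
  transport := (u i).transport

theorem cval_negFamily (u : ι → D.Mode) (t : ℝ) (θ : (ℝ → H) → Circle) :
    cval (negFamily u) t θ = -cval u t θ := by
  simp only [cval, negFamily, ← Finset.sum_neg_distrib, neg_mul, Complex.neg_re]

theorem cgrad_negFamily (u : ι → D.Mode) (t : ℝ) (θ : (ℝ → H) → Circle) :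
    cgrad (negFamily u) t θ = -cgrad u t θ := by
  simp only [cgrad, negFamily, ← Finset.sum_neg_distrib, neg_mul, Complex.neg_im, neg_smul]

theorem cev_negFamily (u : ι → D.Mode) (t : ℝ) (θ : (ℝ → H) → Circle) :
    cev (negFamily u) t θ = -cev u t θ := by
  rw [cev, cev, ← Finset.sum_neg_distrib]
  refine Finset.sum_congr rfl fun i _ => ?_
  have : deriv (negFamily u i).c t = -deriv (u i).c t := ((u i).hasDerivAt_c t).neg.deriv
  rw [← Complex.neg_re, ← neg_mul, Mode.evol, this]
  simp only [Mode.evol, negFamily]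
  congr 2
  ring

theorem abs_cval_le (u : ι → D.Mode) {M : ℝ} (hM : 0 ≤ M) {w : ℝ → ((ℝ → H) → Circle) → H}
    (h : ∀ t ∈ Icc 0 D.T, ∀ θ, IsChar θ → |cev u t θ + ⟪w t θ, cgrad u t θ⟫_ℝ| ≤ M)
    {t : ℝ} (ht : t ∈ Icc 0 D.T) {θ : (ℝ → H) → Circle} (hθ : IsChar θ) :
    |cval u t θ| ≤ M * D.T := by
  refine abs_le'.2 ⟨cval_le_of_le u hM (fun t ht θ hθ => (abs_le.1 (h t ht θ hθ)).1) ht hθ, ?_⟩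
  rw [← cval_negFamily]
  refine cval_le_of_le (w := w) _ hM (fun t ht θ hθ => ?_) ht hθ
  rw [cev_negFamily, cgrad_negFamily, inner_neg_right]
  linarith [(abs_le.1 (h t ht θ hθ)).2]

end FPData

end MaximumPrinciple
section ApproximateSolutions

open Complex (I)
open scoped ComplexConjugate

variable {H : Type} [NormedAddCommGroup H] [InnerProductSpace ℝ H] [CompleteSpace H]
  [SecondCountableTopology H] [MeasurableSpace H] [BorelSpace H]

theorem IsChar.coe_neg {θ : (ℝ → H) → Circle} (hθ : IsChar θ) (k : ℝ → H) :
    (θ (-k) : ℂ) = conj (θ k : ℂ) := by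
  have h0 : θ 0 = 1 := by
    have : θ 0 * θ 0 = θ 0 * 1 := by rw [mul_one, ← hθ, add_zero]
    exact mul_left_cancel this
  have h1 : θ (-k) = (θ k)⁻¹ := eq_inv_of_mul_eq_one_left (by rw [← hθ, neg_add_cancel, h0])
  rw [h1, Circle.coe_inv_eq_conj]

namespace FPData

variable (D : FPData H)

/-- A source term `φ(t) e^{i⟨x, k(t)⟩}` with continuous amplitude. -/
structure Src where
  φ : ℝ → ℂ
  k : ℝ → H
  b : ℝ
  b_le : b ≤ D.T
  cont : Continuous φ
  vanish : ∀ t, b ≤ t → φ t = 0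
  transport : D.Transport b k

variable {D}

namespace Src

variable (g : D.Src)

theorem continuous_k : Continuous g.k := g.transport.contDiff.continuous

/-- The quadratic form `⟨C k, k⟩` along the frequency curve. -/
noncomputable def q (t : ℝ) : ℝ := ⟪D.C (g.k t), g.k t⟫_ℝ

theorem continuous_q : Continuous g.q := by
  have := g.continuous_k
  unfold q
  fun_prop

/-- Half the primitive of `q`. -/
noncomputable def P (t : ℝ) : ℝ := 1 / 2 * ∫ r in (0 : ℝ)..t, g.q r

theorem hasDerivAt_P (t : ℝ) : HasDerivAt g.P (1 / 2 * g.q t) t :=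
  (intervalIntegral.integral_hasDerivAt_right (g.continuous_q.intervalIntegrable _ _)
    g.continuous_q.stronglyMeasurable.stronglyMeasurableAtFilter
    g.continuous_q.continuousAt).const_mul _

theorem continuous_P : Continuous g.P :=
  continuous_iff_continuousAt.2 fun t => (g.hasDerivAt_P t).continuousAt

/-- The amplitude of the backward solution with right-hand side `g`. -/
noncomputable def amp (t : ℝ) : ℂ :=
  (Real.exp (g.P t) : ℂ) * ∫ r in g.b..t, (Real.exp (-g.P r) : ℂ) * g.φ r

theorem hasDerivAt_amp (t : ℝ) :
    HasDerivAt g.amp (1 / 2 * (g.q t : ℂ) * g.amp t + g.φ t) t := by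
  have hP := g.continuous_P
  have hφ := g.cont
  have hc : Continuous fun r => (Real.exp (-g.P r) : ℂ) * g.φ r := by fun_prop
  have h1 := intervalIntegral.integral_hasDerivAt_right (hc.intervalIntegrable g.b t)
    hc.stronglyMeasurable.stronglyMeasurableAtFilter hc.continuousAt
  refine ((g.hasDerivAt_P t).exp.ofReal_comp.mul h1).congr_deriv ?_
  have h2 : (Real.exp (g.P t) : ℂ) * (Real.exp (-g.P t) : ℂ) = 1 := by
    rw [← Complex.ofReal_mul, ← Real.exp_add, add_neg_cancel, Real.exp_zero, Complex.ofReal_one]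
  rw [amp, Complex.ofReal_mul, Complex.ofReal_mul, Complex.ofReal_div, Complex.ofReal_one,
    Complex.ofReal_ofNat]
  linear_combination g.φ t * h2

theorem amp_vanish {t : ℝ} (ht : g.b ≤ t) : g.amp t = 0 := by
  have : ∫ r in g.b..t, (Real.exp (-g.P r) : ℂ) * g.φ r = ∫ r in g.b..t, (0 : ℂ) :=
    intervalIntegral.integral_congr fun r hr => by
      rw [uIcc_of_le ht] at hr
      simp [g.vanish r hr.1]
  rw [amp, this]
  simp

/-- The mode solving the backward Ornstein–Uhlenbeck equation with right-hand side `g`. -/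
noncomputable def solve : D.Mode where
  c := g.amp
  k := g.k
  b := g.b
  b_le := g.b_le
  contDiff := by
    refine contDiff_one_of_hasDerivAt g.hasDerivAt_amp ?_
    have h1 : Continuous g.amp :=
      continuous_iff_continuousAt.2 fun t => (g.hasDerivAt_amp t).continuousAt
    have h2 := g.cont
    have h3 := g.continuous_q
    fun_prop
  vanish _ ht := g.amp_vanish ht
  transport := g.transport

theorem evol_solve (t : ℝ) : g.solve.evol t = g.φ t := by
  have : deriv g.solve.c t = _ := (g.hasDerivAt_amp t).deriv
  rw [Mode.evol, this]
  simp only [solve, q]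
  ring

/-- The smoothing estimate for the backward equation. -/
theorem norm_k_mul_amp_le {α lam κ E : ℝ} (hα : 0 < α) (hlam : 0 < lam) (hκ : 0 < κ)
    (hκl : 1 ≤ 4 * κ ^ 2 * α * lam)
    (hq : ∀ t r, 0 ≤ t → t ≤ r → r ≤ g.b → 2 * α * ‖g.k t‖ ^ 2 ≤ g.q r)
    (hE : ∀ t ∈ Icc 0 D.T, ‖g.φ t‖ ≤ E * Real.exp (lam * (D.T - t))) {t : ℝ}
    (ht : t ∈ Icc 0 D.T) :
    ‖g.k t‖ * ‖g.amp t‖ ≤ κ * (E * Real.exp (lam * (D.T - t))) := by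
  have hEe : 0 ≤ E * Real.exp (lam * (D.T - t)) := (norm_nonneg _).trans (hE t ht)
  rcases le_total g.b t with hb | hb
  · rw [g.amp_vanish hb, norm_zero, mul_zero]
    positivity
  set x := ‖g.k t‖ with hx
  set β := lam + α * x ^ 2 with hβ
  have hβ0 : 0 < β := by positivity
  have hamp : ‖g.amp t‖ ≤ E * Real.exp (lam * (D.T - t)) / β := by
    have e : g.amp t = -∫ r in t..g.b, (Real.exp (g.P t - g.P r) : ℂ) * g.φ r := by
      rw [amp, intervalIntegral.integral_symm, mul_neg, ← intervalIntegral.integral_const_mul]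
      congr 2
      funext r
      rw [sub_eq_add_neg, Real.exp_add]
      push_cast
      ring
    have hd : ∀ r, HasDerivAt (fun r => -Real.exp (-β * (r - t)) / β)
        (Real.exp (-β * (r - t))) r := fun r => by
      have h1 := ((((hasDerivAt_id r).sub_const t).const_mul (-β)).exp.neg.div_const β)
      refine h1.congr_deriv ?_
      simp only [id]
      field_simp
    have hint : ∫ r in t..g.b, Real.exp (-β * (r - t)) ≤ 1 / β := by
      rw [intervalIntegral.integral_eq_sub_of_hasDerivAt (fun r _ => hd r)
        ((by fun_prop : Continuous fun r => Real.exp (-β * (r - t))).intervalIntegrable _ _)]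
      simp only [sub_self, mul_zero, Real.exp_zero]
      rw [div_sub_div_same]
      gcongr
      linarith [Real.exp_pos (-β * (g.b - t))]
    rw [e, norm_neg]
    have hpt : ∀ r ∈ Ioc t g.b, ‖(Real.exp (g.P t - g.P r) : ℂ) * g.φ r‖ ≤
        E * Real.exp (lam * (D.T - t)) * Real.exp (-β * (r - t)) := fun r hr => by
      have hr' : r ∈ Icc 0 D.T := ⟨ht.1.trans hr.1.le, hr.2.trans g.b_le⟩
      have hP : g.P t - g.P r ≤ -(α * x ^ 2) * (r - t) := by
        have h1 : g.P r - g.P t = 1 / 2 * ∫ y in t..r, g.q y := by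
          rw [P, P, ← mul_sub, intervalIntegral.integral_interval_sub_left
            (g.continuous_q.intervalIntegrable _ _) (g.continuous_q.intervalIntegrable _ _)]
        have h2 : ∫ y in t..r, 2 * α * x ^ 2 ≤ ∫ y in t..r, g.q y :=
          intervalIntegral.integral_mono_on hr.1.le (by simp)
            (g.continuous_q.intervalIntegrable _ _)
            fun y hy => hq t y ht.1 hy.1 (hy.2.trans hr.2)
        rw [intervalIntegral.integral_const, smul_eq_mul] at h2
        linarith
      rw [norm_mul, Complex.norm_real, Real.norm_eq_abs, Real.abs_exp]
      have hE0 : 0 ≤ E := by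
        by_contra! h
        exact absurd hEe (not_le.2 (mul_neg_of_neg_of_pos h (Real.exp_pos _)))
      calc _ ≤ Real.exp (-(α * x ^ 2) * (r - t)) * (E * Real.exp (lam * (D.T - r))) := by
            gcongr
            exact hE r hr'
        _ = E * (Real.exp (-(α * x ^ 2) * (r - t)) * Real.exp (lam * (D.T - r))) := by ring
        _ = E * (Real.exp (lam * (D.T - t)) * Real.exp (-β * (r - t))) := by
            rw [← Real.exp_add, ← Real.exp_add, hβ]
            ring_nf
        _ = _ := by ring
    refine (intervalIntegral.norm_integral_le_of_norm_le hb (.of_forall hpt)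
      ((by fun_prop : Continuous fun r => E * Real.exp (lam * (D.T - t)) *
        Real.exp (-β * (r - t))).intervalIntegrable _ _)).trans ?_
    rw [intervalIntegral.integral_const_mul, div_eq_mul_one_div _ β]
    gcongr
  have hxβ : x ≤ κ * β := by
    have : 0 ≤ 4 * κ * α * (κ * β - x) := by
      rw [hβ]
      nlinarith [sq_nonneg (2 * κ * α * x - 1)]
    by_contra! h
    exact absurd this (not_le.2 (mul_neg_of_pos_of_neg (by positivity) (by linarith)))
  calc x * ‖g.amp t‖ ≤ (κ * β) * (E * Real.exp (lam * (D.T - t)) / β) := by gcongr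
    _ = _ := by field_simp

/-- The complex conjugate of a source. -/
noncomputable def star : D.Src where
  φ t := conj (g.φ t)
  k := -g.k
  b := g.b
  b_le := g.b_le
  cont := Complex.continuous_conj.comp g.cont
  vanish t ht := by simp [g.vanish t ht]
  transport := g.transport.neg

/-- The source with opposite amplitude. -/
noncomputable def neg : D.Src where
  φ t := -g.φ t
  k := g.k
  b := g.b
  b_le := g.b_le
  cont := g.cont.neg
  vanish t ht := by simp [g.vanish t ht]
  transport := g.transport

/-- Half the product of the source `g` with the derivative of the mode `m` along `a`. -/
noncomputable def couple (a : H) (m : D.Mode) : D.Src where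
  φ t := 1 / 2 * g.φ t * (I * (⟪a, m.k t⟫_ℝ : ℂ) * m.c t)
  k := g.k + m.k
  b := min g.b m.b
  b_le := (min_le_left _ _).trans g.b_le
  cont := by
    have h1 := g.cont
    have h2 := m.continuous_c
    have h3 := m.continuous_k
    fun_prop
  vanish t ht := by
    rcases min_le_iff.1 ht with h | h
    · simp [g.vanish t h]
    · simp [m.vanish t h]
  transport := (g.transport.mono (min_le_left _ _)).add (m.transport.mono (min_le_right _ _))

theorem norm_couple_le (a : H) (m : D.Mode) (t : ℝ) :
    ‖(g.couple a m).φ t‖ ≤ 1 / 2 * (‖g.φ t‖ * ‖a‖) * (‖m.k t‖ * ‖m.c t‖) := by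
  simp only [couple, norm_mul, Complex.norm_I, Complex.norm_real, one_mul]
  have := norm_inner_le_norm (𝕜 := ℝ) a (m.k t)
  calc _ ≤ ‖(1 / 2 : ℂ)‖ * ‖g.φ t‖ * (‖a‖ * ‖m.k t‖ * ‖m.c t‖) := by gcongr
    _ = _ := by
      rw [show ‖(1 / 2 : ℂ)‖ = 1 / 2 by norm_num]
      ring

theorem couple_add_star {θ : (ℝ → H) → Circle} (hθ : IsChar θ) (a : H) (m : D.Mode) (t : ℝ) :
    ((g.couple a m).φ t * θ (g.couple a m).k).re +
      ((g.star.couple a m).φ t * θ (g.star.couple a m).k).re =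
      (g.φ t * θ g.k).re * ⟪a, m.k t⟫_ℝ * -(m.c t * θ m.k).im := by
  have h1 : θ (g.k + m.k) = θ g.k * θ m.k := hθ g.k m.k
  have h2 : θ (-g.k + m.k) = θ (-g.k) * θ m.k := hθ (-g.k) m.k
  have h3 := hθ.coe_neg g.k
  simp only [couple, star, h1, h2, Circle.coe_mul, h3]
  simp
  ring

end Src

variable {ι J : Type} [Fintype ι] [Fintype J]

/-- The value of a family of sources at a functional. -/
noncomputable def csrc (g : ι → D.Src) (t : ℝ) (θ : (ℝ → H) → Circle) : ℝ :=
  ∑ i, ((g i).φ t * θ (g i).k).re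

/-- The trigonometric vector field with coefficients `σ` and directions `a`. -/
noncomputable def cfield (σ : J → D.Src) (a : J → H) (t : ℝ) (θ : (ℝ → H) → Circle) : H :=
  ∑ j, ((σ j).φ t * θ (σ j).k).re • a j

/-- The family of sources `⟨F, D v⟩` for a trigonometric vector field `F`. -/
noncomputable def coupleFamily (σ : J → D.Src) (a : J → H) (v : ι → D.Mode) :
    (ι × J) ⊕ (ι × J) → D.Src :=
  Sum.elim (fun ij => (σ ij.2).couple (a ij.2) (v ij.1))
    fun ij => (σ ij.2).star.couple (a ij.2) (v ij.1)

theorem csrc_coupleFamily (σ : J → D.Src) (a : J → H) (v : ι → D.Mode) (t : ℝ)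
    {θ : (ℝ → H) → Circle} (hθ : IsChar θ) :
    csrc (coupleFamily σ a v) t θ = ⟪cfield σ a t θ, cgrad v t θ⟫_ℝ := by
  rw [csrc, Fintype.sum_sum_type, ← Finset.sum_add_distrib]
  simp only [coupleFamily, Sum.elim_inl, Sum.elim_inr, Src.couple_add_star _ hθ]
  rw [Fintype.sum_prod_type]
  simp only [cfield, cgrad, sum_inner, inner_sum, real_inner_smul_left, real_inner_smul_right]
  exact Finset.sum_congr rfl fun i _ => Finset.sum_congr rfl fun j _ => by ring

/-- Total exponentially weighted size of the amplitudes of a family of sources. -/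
def SrcBound (lam : ℝ) (g : ι → D.Src) (E : ℝ) : Prop :=
  ∃ e : ι → ℝ, ∑ i, e i ≤ E ∧
    ∀ i, ∀ t ∈ Icc 0 D.T, ‖(g i).φ t‖ ≤ e i * Real.exp (lam * (D.T - t))

theorem SrcBound.neg {lam E : ℝ} {g : ι → D.Src} (h : SrcBound lam g E) :
    SrcBound lam (fun i => (g i).neg) E := by
  obtain ⟨e, h1, h2⟩ := h
  exact ⟨e, h1, fun i t ht => by simpa [Src.neg] using h2 i t ht⟩

theorem csrc_neg (g : ι → D.Src) (t : ℝ) (θ : (ℝ → H) → Circle) :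
    csrc (fun i => (g i).neg) t θ = -csrc g t θ := by
  simp only [csrc, Src.neg, ← Finset.sum_neg_distrib, neg_mul, Complex.neg_re]

theorem SrcBound.abs_csrc_le {lam E : ℝ} (hlam : 0 ≤ lam) {g : ι → D.Src} (h : SrcBound lam g E)
    {t : ℝ} (ht : t ∈ Icc 0 D.T) (θ : (ℝ → H) → Circle) :
    |csrc g t θ| ≤ E * Real.exp (lam * D.T) := by
  obtain ⟨e, h1, h2⟩ := h
  have he : ∀ i, 0 ≤ e i := fun i => by
    have := (norm_nonneg _).trans (h2 i t ht)
    exact nonneg_of_mul_nonneg_left this (Real.exp_pos _)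
  calc |csrc g t θ| ≤ ∑ i, e i * Real.exp (lam * D.T) := by
        refine (Finset.abs_sum_le_sum_abs _ _).trans (Finset.sum_le_sum fun i _ => ?_)
        refine (Complex.abs_re_le_norm _).trans ?_
        rw [norm_mul, Circle.norm_coe, mul_one]
        refine (h2 i t ht).trans ?_
        have := he i
        gcongr
        linarith [ht.1]
    _ ≤ _ := by
        rw [← Finset.sum_mul]
        gcongr

theorem exists_iterated_solution {α lam κ : ℝ} (hα : 0 < α) (hlam : 0 < lam) (hκ : 0 < κ)
    (hκl : 1 ≤ 4 * κ ^ 2 * α * lam)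
    (hq : ∀ g : D.Src, ∀ t r, 0 ≤ t → t ≤ r → r ≤ g.b → 2 * α * ‖g.k t‖ ^ 2 ≤ g.q r)
    (σ : J → D.Src) (a : J → H) {B : J → ℝ} (hB : ∀ j, ∀ t ∈ Icc 0 D.T, ‖(σ j).φ t‖ ≤ B j)
    (hκB : κ * ∑ j, B j * ‖a j‖ ≤ 1 / 2) (n : ℕ) :
    ∀ (ι : Type) [Fintype ι] (g : ι → D.Src) (E : ℝ), SrcBound lam g E →
      ∃ (ι₁ : Type) (_ : Fintype ι₁) (u : ι₁ → D.Mode) (ι₂ : Type) (_ : Fintype ι₂)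
        (e : ι₂ → D.Src), SrcBound lam e (E / 2 ^ n) ∧ ∀ t θ, IsChar θ →
          cev u t θ + ⟪cfield σ a t θ, cgrad u t θ⟫_ℝ = csrc g t θ + csrc e t θ := by
  induction n with
  | zero =>
    intro ι _ g E hg
    refine ⟨Empty, inferInstance, Empty.elim, ι, inferInstance, fun i => (g i).neg,
      by simpa using hg.neg, fun t θ _ => ?_⟩
    rw [csrc_neg]
    simp [cev, cgrad]
  | succ n ih =>
    intro ι _ g E hg
    set v : ι → D.Mode := fun i => (g i).solve with hv
    have hS : SrcBound lam (coupleFamily σ a v) (E / 2) := by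
      obtain ⟨e, h1, h2⟩ := hg
      have he : ∀ i, 0 ≤ e i := fun i => by
        have := (norm_nonneg _).trans (h2 i 0 ⟨le_rfl, D.hT.le⟩)
        exact nonneg_of_mul_nonneg_left this (Real.exp_pos _)
      have hB0 : ∀ j, 0 ≤ B j := fun j => (norm_nonneg _).trans (hB j 0 ⟨le_rfl, D.hT.le⟩)
      have key : ∀ (i : ι) (j : J) (s : D.Src), (∀ t ∈ Icc 0 D.T, ‖s.φ t‖ ≤ B j) →
          ∀ t ∈ Icc 0 D.T, ‖(s.couple (a j) (v i)).φ t‖ ≤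
            1 / 2 * (B j * ‖a j‖) * κ * e i * Real.exp (lam * (D.T - t)) := fun i j s hs t ht => by
        refine (s.norm_couple_le _ _ t).trans ?_
        have h3 := (g i).norm_k_mul_amp_le hα hlam hκ hκl (hq (g i)) (h2 i) ht
        have h4 := hs t ht
        have h5 := hB0 j
        calc _ ≤ 1 / 2 * (B j * ‖a j‖) * (κ * (e i * Real.exp (lam * (D.T - t)))) := by
              refine mul_le_mul ?_ h3 (by positivity) (by positivity)
              gcongr
          _ = _ := by ring
      refine ⟨Sum.elim (fun ij => 1 / 2 * (B ij.2 * ‖a ij.2‖) * κ * e ij.1)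
        fun ij => 1 / 2 * (B ij.2 * ‖a ij.2‖) * κ * e ij.1, ?_, ?_⟩
      · rw [Fintype.sum_sum_type, ← Finset.sum_add_distrib]
        simp only [Sum.elim_inl, Sum.elim_inr]
        rw [Fintype.sum_prod_type]
        have h6 : ∑ i, ∑ j, (1 / 2 * (B j * ‖a j‖) * κ * e i + 1 / 2 * (B j * ‖a j‖) * κ * e i) =
            (κ * ∑ j, B j * ‖a j‖) * ∑ i, e i := by
          rw [Finset.mul_sum, Finset.mul_sum]
          refine Finset.sum_congr rfl fun i _ => ?_
          rw [Finset.sum_mul]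
          exact Finset.sum_congr rfl fun j _ => by ring
        rw [h6]
        have h7 : 0 ≤ ∑ i, e i := Finset.sum_nonneg fun i _ => he i
        calc _ ≤ 1 / 2 * ∑ i, e i := by gcongr
          _ ≤ E / 2 := by linarith
      · rintro (⟨i, j⟩ | ⟨i, j⟩) t ht
        · exact key i j (σ j) (hB j) t ht
        · exact key i j (σ j).star (fun t ht => by simpa [Src.star] using hB j t ht) t ht
    obtain ⟨ι₁, _, u, ι₂, _, e, he, hu⟩ := ih _ _ _ hS.neg
    refine ⟨ι ⊕ ι₁, inferInstance, Sum.elim v u, ι₂, inferInstance, e, ?_, fun t θ hθ => ?_⟩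
    · convert he using 1
      rw [pow_succ]
      ring
    · have h1 : cev (Sum.elim v u) t θ = cev v t θ + cev u t θ := by
        rw [cev, Fintype.sum_sum_type]
        rfl
      have h2 : cgrad (Sum.elim v u) t θ = cgrad v t θ + cgrad u t θ := by
        rw [cgrad, Fintype.sum_sum_type]
        rfl
      have h3 : cev v t θ = csrc g t θ := by
        simp only [cev, csrc, hv, Src.evol_solve]
        rfl
      have h4 := hu t θ hθ
      rw [csrc_neg, csrc_coupleFamily _ _ _ _ hθ] at h4
      rw [h1, h2, h3, inner_add_right]
      linarith

/-- Approximate solvability of the backward Kolmogorov equation with trigonometric drift. -/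
theorem exists_approx_solution {c₀ : ℝ} (hc₀ : 0 < c₀) (hC : ∀ x, c₀ * ‖x‖ ^ 2 ≤ ⟪D.C x, x⟫_ℝ)
    (σ : J → D.Src) (a : J → H) (g : ι → D.Src) {ε : ℝ} (hε : 0 < ε) :
    ∃ (ι₁ : Type) (_ : Fintype ι₁) (u : ι₁ → D.Mode), ∀ t ∈ Icc 0 D.T, ∀ θ, IsChar θ →
      |cev u t θ + ⟪cfield σ a t θ, cgrad u t θ⟫_ℝ - csrc g t θ| ≤ ε := by
  have hbd : ∀ s : D.Src, ∃ B, ∀ t ∈ Icc 0 D.T, ‖s.φ t‖ ≤ B := fun s =>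
    isCompact_Icc.exists_bound_of_continuousOn s.cont.continuousOn
  choose B hB using fun j => hbd (σ j)
  choose G hG using fun i => hbd (g i)
  obtain ⟨M, hM0, hM⟩ := D.exists_norm_S_le D.T
  set α := c₀ / (2 * M ^ 2) with hα
  have hα0 : 0 < α := by positivity
  have hq : ∀ g : D.Src, ∀ t r, 0 ≤ t → t ≤ r → r ≤ g.b → 2 * α * ‖g.k t‖ ^ 2 ≤ g.q r := by
    intro g t r h0 htr hr
    have h1 : ‖g.k t‖ ≤ M * ‖g.k r‖ := by
      rw [g.transport.flow t r htr hr]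
      refine (ContinuousLinearMap.adjoint (D.S (r - t))).le_of_opNorm_le ?_ _
      rw [LinearIsometryEquiv.norm_map]
      exact hM _ ⟨sub_nonneg.2 htr, by linarith [g.b_le]⟩
    refine le_trans ?_ (hC (g.k r))
    calc 2 * α * ‖g.k t‖ ^ 2 ≤ 2 * α * (M * ‖g.k r‖) ^ 2 := by gcongr
      _ = _ := by rw [hα]; field_simp
  set A := ∑ j, B j * ‖a j‖ with hA
  have hA0 : 0 ≤ A := Finset.sum_nonneg fun j _ =>
    mul_nonneg ((norm_nonneg _).trans (hB j 0 ⟨le_rfl, D.hT.le⟩)) (norm_nonneg _)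
  set κ := 1 / (2 * (A + 1)) with hκ
  have hκ0 : 0 < κ := by positivity
  set lam := 1 / (4 * κ ^ 2 * α) with hlam
  have hlam0 : 0 < lam := by positivity
  have hκl : 1 ≤ 4 * κ ^ 2 * α * lam := by
    rw [hlam, mul_one_div_cancel (by positivity)]
  have hκB : κ * A ≤ 1 / 2 := by
    rw [hκ, one_div_mul_eq_div, div_le_div_iff₀ (by positivity) two_pos]
    linarith
  have hg : SrcBound lam g (∑ i, G i) := by
    refine ⟨G, le_rfl, fun i t ht => (hG i t ht).trans (le_mul_of_one_le_right ?_ ?_)⟩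
    · exact (norm_nonneg _).trans (hG i t ht)
    · exact Real.one_le_exp (mul_nonneg hlam0.le (sub_nonneg.2 ht.2))
  obtain ⟨n, hn⟩ : ∃ n : ℕ, (∑ i, G i) / 2 ^ n * Real.exp (lam * D.T) ≤ ε := by
    have h1 : Tendsto (fun n : ℕ => (∑ i, G i) * (1 / 2 : ℝ) ^ n * Real.exp (lam * D.T)) atTop
        (𝓝 ((∑ i, G i) * 0 * Real.exp (lam * D.T))) :=
      ((tendsto_pow_atTop_nhds_zero_of_lt_one (by norm_num) (by norm_num)).const_mul _).mul_const _
    rw [mul_zero, zero_mul] at h1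
    obtain ⟨n, hn⟩ := (h1.eventually_le_const hε).exists
    refine ⟨n, le_trans (le_of_eq ?_) hn⟩
    rw [one_div, inv_pow, div_eq_mul_inv]
  obtain ⟨ι₁, i₁, u, ι₂, _, e, he, hu⟩ :=
    exists_iterated_solution hα0 hlam0 hκ0 hκl hq σ a hB hκB n ι g _ hg
  refine ⟨ι₁, i₁, u, fun t ht θ hθ => ?_⟩
  rw [hu t θ hθ, add_sub_cancel_left]
  exact (he.abs_csrc_le hlam0.le ht θ).trans hn

end FPData

end ApproximateSolutions
section Separation

open Complex (I)

variable {H : Type} [NormedAddCommGroup H] [InnerProductSpace ℝ H] [CompleteSpace H]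
  [SecondCountableTopology H] [MeasurableSpace H] [BorelSpace H]

/-- The piecewise linear cutoff, equal to `1` for `y ≤ -1` and to `0` for `0 ≤ y`. -/
noncomputable def ramp (y : ℝ) : ℝ := max 0 (min 1 (-y))

theorem continuous_ramp : Continuous ramp := by
  unfold ramp
  fun_prop

theorem antitone_ramp : Antitone ramp := fun y z h => by
  unfold ramp
  gcongr

theorem ramp_of_nonneg {y : ℝ} (h : 0 ≤ y) : ramp y = 0 := by
  rw [ramp, max_eq_left ((min_le_right _ _).trans (by linarith))]

theorem ramp_of_le {y : ℝ} (h : y ≤ -1) : ramp y = 1 := by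
  rw [ramp, min_eq_left (by linarith), max_eq_right zero_le_one]

theorem ramp_nonneg (y : ℝ) : 0 ≤ ramp y := le_max_left _ _

theorem ramp_le_one (y : ℝ) : ramp y ≤ 1 := max_le zero_le_one (min_le_left _ _)

/-- The hat function supported in `[-1, 1]`. -/
noncomputable def hat (y : ℝ) : ℝ := ramp (y - 1) - ramp y

theorem continuous_hat : Continuous hat :=
  (continuous_ramp.comp (continuous_id.sub continuous_const)).sub continuous_ramp

theorem hat_nonneg (y : ℝ) : 0 ≤ hat y := sub_nonneg.2 (antitone_ramp (by linarith))

theorem hat_of_le {y : ℝ} (h : y ≤ -1) : hat y = 0 := by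
  rw [hat, ramp_of_le h, ramp_of_le (by linarith), sub_self]

theorem hat_of_ge {y : ℝ} (h : 1 ≤ y) : hat y = 0 := by
  rw [hat, ramp_of_nonneg (by linarith), ramp_of_nonneg (by linarith), sub_self]

theorem sum_hat (y : ℝ) (n : ℕ) :
    ∑ j : Fin n, hat (y - (j : ℕ)) = ramp (y - n) - ramp y := by
  rw [Fin.sum_univ_eq_sum_range (fun j => hat (y - j))]
  have := Finset.sum_range_sub (fun j : ℕ => ramp (y - j)) n
  simp only [Nat.cast_zero, sub_zero] at this
  rw [← this]
  refine Finset.sum_congr rfl fun j _ => ?_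
  rw [hat]
  push_cast
  ring_nf

theorem norm_exp_sub_exp_le (a b : ℝ) :
    ‖Complex.exp (a * I) - Complex.exp (b * I)‖ ≤ |a - b| := by
  have h : Complex.exp (a * I) - Complex.exp (b * I) =
      Complex.exp (b * I) * (Complex.exp (I * (a - b : ℝ)) - 1) := by
    rw [mul_sub, ← Complex.exp_add]
    push_cast
    ring_nf
  rw [h, norm_mul, Complex.norm_exp_ofReal_mul_I, one_mul]
  exact Real.norm_exp_I_mul_ofReal_sub_one_le

namespace FPData

variable {D : FPData H}

namespace Src

variable (g : D.Src)

/-- The value of a source at a space-time point. -/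
noncomputable def val (p : ℝ × H) : ℂ := g.φ p.1 * evalChar p g.k

theorem continuous_val : Continuous g.val := by
  have h1 := g.cont
  have h2 := g.continuous_k
  unfold val evalChar
  simp only [Circle.coe_exp]
  fun_prop

theorem norm_val (p : ℝ × H) : ‖g.val p‖ = ‖g.φ p.1‖ := by
  rw [val, norm_mul, Circle.norm_coe, mul_one]

theorem exists_norm_val_le : ∃ B, 0 ≤ B ∧ ∀ p : ℝ × H, p.1 ∈ Icc 0 D.T → ‖g.val p‖ ≤ B := by
  obtain ⟨B, hB⟩ :=
    (isCompact_Icc (a := (0 : ℝ)) (b := D.T)).exists_bound_of_continuousOn g.cont.continuousOn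
  exact ⟨B, (norm_nonneg _).trans (hB 0 ⟨le_rfl, D.hT.le⟩),
    fun p hp => (g.norm_val p).trans_le (hB _ hp)⟩

theorem integrable_val {ν : Measure (ℝ × H)} [IsFiniteMeasure ν]
    (hν : ∀ᵐ p ∂ν, p.1 ∈ Ico 0 D.T) : Integrable g.val ν := by
  obtain ⟨B, -, hB⟩ := g.exists_norm_val_le
  refine Integrable.of_bound g.continuous_val.aestronglyMeasurable B ?_
  filter_upwards [hν] with p hp using hB p ⟨hp.1, hp.2.le⟩

/-- The source with amplitude multiplied by `-i`. -/
noncomputable def rot : D.Src where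
  φ t := -I * g.φ t
  k := g.k
  b := g.b
  b_le := g.b_le
  cont := continuous_const.mul g.cont
  vanish t ht := by rw [g.vanish t ht, mul_zero]
  transport := g.transport

theorem re_val_rot (p : ℝ × H) : (g.rot.val p).re = (g.val p).im := by
  simp only [val, rot, mul_assoc]
  simp

end Src

/-- Sources approximating a plane wave near the final time of their frequency curve. -/
theorem exists_hat_src (τ : ℝ) (κ : H) (n : ℕ) (j : Fin (n + 1)) :
    ∃ g : D.Src,
      (∀ t, g.φ t = hat ((n + 1) / D.T * t - (j : ℕ)) * Complex.exp ((τ * t : ℝ) * I)) ∧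
      ∀ p : ℝ × H, ∀ θ : ℝ, (∀ r ∈ Icc 0 (6 * (D.T / (n + 1))), |⟪κ, D.S r p.2 - p.2⟫_ℝ| ≤ θ) →
        ‖g.val p - hat ((n + 1) / D.T * p.1 - (j : ℕ)) *
          Complex.exp ((τ * p.1 + ⟪κ, p.2⟫_ℝ : ℝ) * I)‖ ≤
          hat ((n + 1) / D.T * p.1 - (j : ℕ)) * θ := by
  have hT := D.hT
  set δ := D.T / (n + 1) with hδ
  have hδ0 : 0 < δ := by positivity
  have hdiv : ∀ t, (n + 1) / D.T * t = t / δ := fun t => by rw [hδ]; field_simp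
  obtain ⟨k, hk, hkκ⟩ := D.exists_transport κ ((j + 1 : ℝ) * δ) hδ0
  refine ⟨⟨fun t => hat ((n + 1) / D.T * t - (j : ℕ)) * Complex.exp ((τ * t : ℝ) * I), k,
    (j + 1 : ℝ) * δ, ?_, ?_, fun t ht => ?_, hk⟩, fun t => rfl, fun p θ hθ => ?_⟩
  · have : (j : ℝ) + 1 ≤ n + 1 := by exact_mod_cast j.2
    calc (j + 1 : ℝ) * δ ≤ (n + 1) * δ := by gcongr
      _ = D.T := by rw [hδ]; field_simp
  · have := continuous_hat
    fun_prop
  · rw [hdiv, hat_of_ge, Complex.ofReal_zero, zero_mul]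
    rw [le_sub_iff_add_le, le_div_iff₀ hδ0]
    linarith
  · by_cases hp : p.1 ∈ Icc ((j + 1 : ℝ) * δ - 2 * δ) ((j + 1 : ℝ) * δ)
    · have h1 := hkκ p.1 hp p.2 θ hθ
      simp only [Src.val, evalChar, Circle.coe_exp]
      rw [mul_assoc, ← Complex.exp_add, ← add_mul, ← Complex.ofReal_add, ← mul_sub, norm_mul,
        Complex.norm_real, Real.norm_of_nonneg (hat_nonneg _)]
      refine mul_le_mul_of_nonneg_left ?_ (hat_nonneg _)
      refine (norm_exp_sub_exp_le _ _).trans (le_trans (le_of_eq ?_) h1)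
      rw [inner_sub_left, real_inner_comm (k p.1) p.2]
      ring_nf
    · have h0 : hat ((n + 1) / D.T * p.1 - (j : ℕ)) = 0 := by
        rw [hdiv]
        rw [mem_Icc, not_and_or, not_le, not_le] at hp
        rcases hp with h | h
        · refine hat_of_le ?_
          rw [sub_le_iff_le_add, div_le_iff₀ hδ0]
          linarith
        · refine hat_of_ge ?_
          rw [le_sub_iff_add_le, le_div_iff₀ hδ0]
          linarith
      simp [Src.val, h0]

/-- Plane waves are bounded pointwise limits of sums of sources. -/
theorem exists_src_tendsto (τ : ℝ) (κ : H) :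
    ∃ g : ∀ n : ℕ, Fin (n + 1) → D.Src,
      (∀ n p, ‖∑ j, (g n j).val p‖ ≤ 1) ∧ ∀ p : ℝ × H, p.1 ∈ Ico 0 D.T →
        Tendsto (fun n => ∑ j, (g n j).val p) atTop
          (𝓝 (Complex.exp ((τ * p.1 + ⟪κ, p.2⟫_ℝ : ℝ) * I))) := by
  choose g hgφ hg using fun n => D.exists_hat_src τ κ n
  refine ⟨g, fun n p => ?_, fun p hp => ?_⟩
  · refine (norm_sum_le _ _).trans ?_
    have : ∀ j, ‖(g n j).val p‖ = hat ((n + 1) / D.T * p.1 - (j : ℕ)) := fun j => by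
      rw [Src.norm_val, hgφ, norm_mul, Complex.norm_exp_ofReal_mul_I, Complex.norm_real,
        Real.norm_of_nonneg (hat_nonneg _), mul_one]
    simp only [this]
    rw [sum_hat]
    linarith [ramp_le_one ((n + 1) / D.T * p.1 - (n + 1 : ℕ)), ramp_nonneg ((n + 1) / D.T * p.1)]
  · have hT := D.hT
    rw [Metric.tendsto_atTop']
    intro θ hθ
    have hS : Continuous fun r : ℝ => |⟪κ, D.S (max r 0) p.2 - p.2⟫_ℝ| := by
      have := D.continuous_S_max p.2
      fun_prop
    have hS0 : ∀ᶠ r in 𝓝 (0 : ℝ), |⟪κ, D.S (max r 0) p.2 - p.2⟫_ℝ| < θ / 2 := by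
      refine hS.continuousAt.eventually_lt_const ?_
      simp [D.S_zero, hθ]
    obtain ⟨η, hη, hη'⟩ := Metric.eventually_nhds_iff.1 hS0
    have hlim : Tendsto (fun n : ℕ => 6 * (D.T / ((n : ℝ) + 1))) atTop (𝓝 (6 * 0)) :=
      (tendsto_const_div_atTop_nhds_zero_nat D.T |>.comp (tendsto_add_atTop_nat 1) |>.congr
        fun n => by simp).const_mul 6
    rw [mul_zero] at hlim
    have e1 := hlim.eventually_lt_const hη
    have hlim2 : Tendsto (fun n : ℕ => D.T / ((n : ℝ) + 1)) atTop (𝓝 0) :=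
      (tendsto_const_div_atTop_nhds_zero_nat D.T |>.comp (tendsto_add_atTop_nat 1) |>.congr
        fun n => by simp)
    have e2 := hlim2.eventually_le_const (sub_pos.2 hp.2)
    obtain ⟨N, hN⟩ := (e1.and e2).exists_forall_of_atTop
    refine ⟨N, fun n hn => ?_⟩
    obtain ⟨h1, h2⟩ := hN n hn.le
    have hsum : ∑ j : Fin (n + 1), hat ((n + 1) / D.T * p.1 - (j : ℕ)) = 1 := by
      rw [sum_hat, ramp_of_le, ramp_of_nonneg (mul_nonneg (by positivity) hp.1), sub_zero]
      rw [div_le_iff₀ (by positivity)] at h2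
      rw [div_mul_eq_mul_div, sub_le_iff_le_add, div_le_iff₀ hT]
      push_cast
      nlinarith
    rw [dist_eq_norm]
    have e : Complex.exp ((τ * p.1 + ⟪κ, p.2⟫_ℝ : ℝ) * I) =
        ∑ j : Fin (n + 1), (hat ((n + 1) / D.T * p.1 - (j : ℕ)) : ℂ) *
          Complex.exp ((τ * p.1 + ⟪κ, p.2⟫_ℝ : ℝ) * I) := by
      rw [← Finset.sum_mul, ← Complex.ofReal_sum, hsum, Complex.ofReal_one, one_mul]
    rw [e, ← Finset.sum_sub_distrib]
    calc _ ≤ ∑ j : Fin (n + 1), hat ((n + 1) / D.T * p.1 - (j : ℕ)) * (θ / 2) := by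
          refine (norm_sum_le _ _).trans (Finset.sum_le_sum fun j _ => hg n j p _ fun r hr => ?_)
          have : dist r 0 < η := by
            rw [Real.dist_0_eq_abs, abs_of_nonneg hr.1]
            exact hr.2.trans_lt h1
          have := hη' this
          rw [max_eq_left hr.1] at this
          exact this.le
      _ < θ := by
          rw [← Finset.sum_mul, hsum]
          linarith

/-- Finite measures are determined by their integrals against sources. -/
theorem ext_of_src {ν₁ ν₂ : Measure (ℝ × H)} [IsFiniteMeasure ν₁] [IsFiniteMeasure ν₂]
    (h₁ : ∀ᵐ p ∂ν₁, p.1 ∈ Ico 0 D.T) (h₂ : ∀ᵐ p ∂ν₂, p.1 ∈ Ico 0 D.T)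
    (h : ∀ g : D.Src, ∫ p, g.val p ∂ν₁ = ∫ p, g.val p ∂ν₂) : ν₁ = ν₂ := by
  refine Measure.ext_of_charFunDual (funext fun L => ?_)
  set τ := L (1, 0)
  set κ := (InnerProductSpace.toDual ℝ H).symm (L.comp (.inr ℝ ℝ H)) with hκ
  have hL : ∀ p : ℝ × H, L p = τ * p.1 + ⟪κ, p.2⟫_ℝ := fun p => by
    rw [hκ, InnerProductSpace.toDual_symm_apply]
    have : p = p.1 • (1, 0) + (0, p.2) := by ext <;> simp
    conv_lhs => rw [this, map_add, map_smul, smul_eq_mul, mul_comm]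
    simp [τ]
  obtain ⟨g, hg1, hg⟩ := D.exists_src_tendsto τ κ
  have key : ∀ ν : Measure (ℝ × H), IsFiniteMeasure ν → (∀ᵐ p ∂ν, p.1 ∈ Ico 0 D.T) →
      Tendsto (fun n => ∑ j, ∫ p, (g n j).val p ∂ν) atTop (𝓝 (charFunDual ν L)) := by
    intro ν _ hν
    rw [charFunDual_apply]
    have : Tendsto (fun n => ∫ p, ∑ j, (g n j).val p ∂ν) atTop
        (𝓝 (∫ p, Complex.exp (L p * I) ∂ν)) := by
      refine tendsto_integral_of_dominated_convergence (fun _ => 1)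
        (fun n => (continuous_finsetSum _ fun j _ => (g n j).continuous_val).aestronglyMeasurable)
        (integrable_const _) (fun n => .of_forall (hg1 n)) ?_
      filter_upwards [hν] with p hp
      rw [hL]
      exact hg p hp
    exact this.congr fun n => integral_finsetSum _ fun j _ => (g n j).integrable_val hν
  refine tendsto_nhds_unique (key ν₁ inferInstance h₁) ?_
  simp only [h]
  exact key ν₂ inferInstance h₂

/-- An integrable function orthogonal to all sources vanishes almost everywhere. -/
theorem ae_eq_zero_of_src {ν : Measure (ℝ × H)} (hν : ∀ᵐ p ∂ν, p.1 ∈ Ico 0 D.T) {W : ℝ × H → ℝ}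
    (hW : Integrable W ν) (h : ∀ g : D.Src, ∫ p, W p * (g.val p).re ∂ν = 0) : W =ᵐ[ν] 0 := by
  have hb : ∀ (g : D.Src) {V : ℝ × H → ℝ}, Integrable V ν →
      Integrable (fun p => max (V p) 0 • g.val p) ν := fun g V hV => by
    obtain ⟨B, -, hB⟩ := g.exists_norm_val_le
    refine hV.pos_part.smul_bdd B g.continuous_val.aestronglyMeasurable ?_
    filter_upwards [hν] with p hp using hB p ⟨hp.1, hp.2.le⟩
  have hi : ∀ g : D.Src, Integrable (fun p => (W p : ℂ) * g.val p) ν := fun g => by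
    obtain ⟨B, -, hB⟩ := g.exists_norm_val_le
    refine hW.ofReal.mul_bdd (c := B) g.continuous_val.aestronglyMeasurable ?_
    filter_upwards [hν] with p hp using hB p ⟨hp.1, hp.2.le⟩
  have h0 : ∀ g : D.Src, ∫ p, (W p : ℂ) * g.val p ∂ν = 0 := fun g => by
    refine Complex.ext ?_ ?_
    · rw [Complex.zero_re, ← RCLike.re_eq_complex_re, ← integral_re (hi g), ← h g]
      simp
    · rw [Complex.zero_im, ← RCLike.im_eq_complex_im, ← integral_im (hi g), ← h g.rot]
      simp [Src.re_val_rot]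
  have hm := hW.aemeasurable
  have hfin : ∀ V : ℝ × H → ℝ, Integrable V ν →
      IsFiniteMeasure (ν.withDensity fun p => ENNReal.ofReal (V p)) := fun V hV =>
    isFiniteMeasure_withDensity_ofReal hV.2
  have := hfin W hW
  have := hfin _ hW.neg
  have hac : ∀ V : ℝ × H → ℝ, ∀ᵐ p ∂(ν.withDensity fun p => ENNReal.ofReal (V p)),
      p.1 ∈ Ico 0 D.T := fun V => (withDensity_absolutelyContinuous _ _).ae_le hν
  have heq : (ν.withDensity fun p => ENNReal.ofReal (W p)) =
      ν.withDensity fun p => ENNReal.ofReal ((-W) p) := by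
    refine ext_of_src (hac _) (hac _) fun g => ?_
    rw [integral_withDensity_eq_integral_toReal_smul₀ hm.ennreal_ofReal (by simp),
      integral_withDensity_eq_integral_toReal_smul₀ hm.neg.ennreal_ofReal (by simp)]
    simp only [ENNReal.toReal_ofReal']
    rw [← sub_eq_zero, ← integral_sub (hb g hW) (hb g hW.neg), ← h0 g]
    refine integral_congr_ae (.of_forall fun p => ?_)
    simp only [Pi.neg_apply, ← sub_smul]
    rw [max_zero_sub_max_neg_zero_eq_self]
    exact Complex.real_smul
  rw [withDensity_eq_iff hm.ennreal_ofReal hm.neg.ennreal_ofReal hW.lintegral_lt_top.ne] at heq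
  filter_upwards [heq] with p hp
  have hp' := congrArg ENNReal.toReal hp
  simp only [ENNReal.toReal_ofReal', Pi.neg_apply] at hp'
  rw [Pi.zero_apply, ← max_zero_sub_max_neg_zero_eq_self (W p), hp', sub_self]

end FPData

end Separation
section Density

variable {H : Type} [NormedAddCommGroup H] [InnerProductSpace ℝ H] [CompleteSpace H]
  [SecondCountableTopology H] [MeasurableSpace H] [BorelSpace H]

namespace FPData

variable {D : FPData H}

/-- The space of trigonometric vector fields in `L²(ν; H)`. -/
noncomputable def trigFields (D : FPData H) (ν : Measure (ℝ × H)) : Submodule ℝ (Lp H 2 ν) :=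
  Submodule.span ℝ {v | ∃ (g : D.Src) (a : H), v =ᵐ[ν] fun p => (g.val p).re • a}

theorem exists_cfield_of_mem_trigFields {ν : Measure (ℝ × H)} {v : Lp H 2 ν}
    (hv : v ∈ D.trigFields ν) :
    ∃ (J : Type) (_ : Fintype J) (σ : J → D.Src) (a : J → H),
      v =ᵐ[ν] fun p => cfield σ a p.1 (evalChar p) := by
  induction hv using Submodule.span_induction with
  | mem v hv =>
    obtain ⟨g, a, h⟩ := hv
    refine ⟨Unit, inferInstance, fun _ => g, fun _ => a, ?_⟩
    filter_upwards [h] with p hp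
    rw [hp, cfield, Fintype.sum_unique]
    rfl
  | zero =>
    refine ⟨Empty, inferInstance, Empty.elim, Empty.elim, ?_⟩
    filter_upwards [Lp.coeFn_zero H 2 ν] with p hp
    rw [hp, cfield, Finset.univ_eq_empty, Finset.sum_empty, Pi.zero_apply]
  | add v w _ _ hv hw =>
    obtain ⟨J, _, σ, a, h⟩ := hv
    obtain ⟨J', _, σ', a', h'⟩ := hw
    refine ⟨J ⊕ J', inferInstance, Sum.elim σ σ', Sum.elim a a', ?_⟩
    filter_upwards [h, h', Lp.coeFn_add v w] with p h1 h2 h3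
    rw [h3, Pi.add_apply, h1, h2, cfield, cfield, cfield, Fintype.sum_sum_type]
    rfl
  | smul c v _ hv =>
    obtain ⟨J, _, σ, a, h⟩ := hv
    refine ⟨J, inferInstance, σ, fun j => c • a j, ?_⟩
    filter_upwards [h, Lp.coeFn_smul c v] with p h1 h2
    rw [h2, Pi.smul_apply, h1, cfield, cfield, Finset.smul_sum]
    exact Finset.sum_congr rfl fun j _ => smul_comm _ _ _

theorem topologicalClosure_trigFields {ν : Measure (ℝ × H)} [IsFiniteMeasure ν]
    (hν : ∀ᵐ p ∂ν, p.1 ∈ Ico 0 D.T) : (D.trigFields ν).topologicalClosure = ⊤ := by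
  rw [Submodule.topologicalClosure_eq_top_iff, Submodule.eq_bot_iff]
  intro w hw
  have hmem : MemLp w 2 ν := Lp.memLp w
  have hw1 : Integrable w ν := hmem.integrable one_le_two
  refine (Lp.eq_zero_iff_ae_eq_zero).2 (ae_eq_zero_of_forall_inner (𝕜 := ℝ) fun a => ?_)
  refine ae_eq_zero_of_src hν (hw1.const_inner a) fun g => ?_
  obtain ⟨B, -, hB⟩ := g.exists_norm_val_le
  have hg : MemLp (fun p => (g.val p).re • a) 2 ν := by
    refine MemLp.of_bound ?_ (B * ‖a‖) ?_
    · exact ((Complex.continuous_re.comp g.continuous_val).smul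
        continuous_const).aestronglyMeasurable
    · filter_upwards [hν] with p hp
      rw [norm_smul]
      gcongr
      exact (Complex.abs_re_le_norm _).trans (hB p ⟨hp.1, hp.2.le⟩)
  have h1 := Submodule.inner_right_of_mem_orthogonal
    (Submodule.subset_span ⟨g, a, hg.coeFn_toLp⟩ : hg.toLp ∈ D.trigFields ν) hw
  rw [L2.inner_def] at h1
  rw [← h1]
  refine integral_congr_ae ?_
  filter_upwards [hg.coeFn_toLp] with p hp
  rw [hp, real_inner_smul_left, mul_comm]

/-- Trigonometric vector fields are dense in `L²(ν; H)`. -/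
theorem exists_cfield_approx {ν : Measure (ℝ × H)} [IsFiniteMeasure ν]
    (hν : ∀ᵐ p ∂ν, p.1 ∈ Ico 0 D.T) {F : ℝ × H → H} (hF : MemLp F 2 ν) {ε : ℝ} (hε : 0 < ε) :
    ∃ (J : Type) (_ : Fintype J) (σ : J → D.Src) (a : J → H),
      Integrable (fun p => ‖F p - cfield σ a p.1 (evalChar p)‖ ^ 2) ν ∧
      ∫ p, ‖F p - cfield σ a p.1 (evalChar p)‖ ^ 2 ∂ν ≤ ε ^ 2 := by
  have hmem : hF.toLp ∈ (D.trigFields ν).topologicalClosure := by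
    rw [topologicalClosure_trigFields hν]
    trivial
  obtain ⟨v, hv, hd⟩ := Metric.mem_closure_iff.1 hmem ε hε
  obtain ⟨J, _, σ, a, h⟩ := exists_cfield_of_mem_trigFields hv
  have hae : (fun p => ‖F p - cfield σ a p.1 (evalChar p)‖ ^ 2) =ᵐ[ν]
      fun p => ‖(hF.toLp - v : Lp H 2 ν) p‖ ^ 2 := by
    filter_upwards [h, hF.coeFn_toLp, Lp.coeFn_sub hF.toLp v] with p h1 h2 h3
    rw [h3, Pi.sub_apply, h1, h2]
  refine ⟨J, inferInstance, σ, a,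
    ((Lp.memLp (hF.toLp - v)).integrable_norm_pow two_ne_zero).congr hae.symm, ?_⟩
  rw [integral_congr_ae hae]
  have h4 : ∫ p, ‖(hF.toLp - v : Lp H 2 ν) p‖ ^ 2 ∂ν = ‖hF.toLp - v‖ ^ 2 := by
    rw [← real_inner_self_eq_norm_sq, L2.inner_def]
    simp only [real_inner_self_eq_norm_sq]
  rw [h4, ← dist_eq_norm]
  gcongr

end FPData

end Density
section Uniqueness

variable {H : Type} [NormedAddCommGroup H] [InnerProductSpace ℝ H] [CompleteSpace H]
  [SecondCountableTopology H] [MeasurableSpace H] [BorelSpace H]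

namespace FPData

/-- The diffusion is uniformly nondegenerate when `C` has a bounded left inverse. -/
theorem exists_coercive (D : FPData H) {Cinv : H →L[ℝ] H} (h : Cinv.comp D.C = 1) :
    ∃ c₀ : ℝ, 0 < c₀ ∧ ∀ x, c₀ * ‖x‖ ^ 2 ≤ ⟪D.C x, x⟫_ℝ := by
  set N := ‖Cinv.comp D.sqrtC‖ + 1 with hN
  have hN0 : 0 < N := by positivity
  refine ⟨1 / N ^ 2, by positivity, fun x => ?_⟩
  have h1 : ‖x‖ ≤ N * ‖D.sqrtC x‖ := by
    have h2 : x = Cinv.comp D.sqrtC (D.sqrtC x) := by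
      have h3 : D.sqrtC (D.sqrtC x) = D.C x := by rw [← D.sqrtC_sq]; rfl
      have h4 : Cinv (D.C x) = x := congrArg (fun L : H →L[ℝ] H => L x) h
      rw [ContinuousLinearMap.comp_apply, h3, h4]
    calc ‖x‖ = ‖Cinv.comp D.sqrtC (D.sqrtC x)‖ := by rw [← h2]
      _ ≤ ‖Cinv.comp D.sqrtC‖ * ‖D.sqrtC x‖ := ContinuousLinearMap.le_opNorm _ _
      _ ≤ N * ‖D.sqrtC x‖ := by gcongr; linarith
  rw [← D.inner_sqrtC_sqrtC, real_inner_self_eq_norm_sq, one_div_mul_eq_div,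
    div_le_iff₀ (by positivity)]
  calc ‖x‖ ^ 2 ≤ (N * ‖D.sqrtC x‖) ^ 2 := by gcongr
    _ = _ := by ring

variable {D : FPData H} {ι : Type} [Fintype ι]

theorem continuous_fval (u : ι → D.Mode) : Continuous (fval u) :=
  continuous_finsetSum _ fun i _ => Complex.continuous_re.comp (u i).continuous_pt

theorem WeakSol.integrable_fgen {s : ℝ} {ζ : Measure H} {ν : Measure (ℝ × H)}
    (h : D.WeakSol s ζ ν) (u : ι → D.Mode) : Integrable (fgen u) ν := by
  have := h.finite
  exact integrable_finsetSum _ fun i _ => ((u i).integrable_gen h.memLp h.ae_mem_Icc).re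

theorem WeakSol.integrable_norm_fgrad_sq {s : ℝ} {ζ : Measure H} {ν : Measure (ℝ × H)}
    (h : D.WeakSol s ζ ν) (u : ι → D.Mode) : Integrable (fun p => ‖fgrad u p‖ ^ 2) ν := by
  have := h.finite
  obtain ⟨G, hG⟩ := exists_norm_fgrad_le u
  refine Integrable.of_bound ((continuous_fgrad u).norm.pow 2).aestronglyMeasurable (G ^ 2) ?_
  filter_upwards [h.ae_mem_Icc] with p hp
  rw [norm_pow, norm_norm]
  gcongr
  exact hG p hp

/-- A bounded family of modes solving the equation up to a small error has bounded energy. -/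
theorem WeakSol.integral_norm_fgrad_sq_le {s : ℝ} {ζ : Measure H} [IsFiniteMeasure ζ]
    {ν : Measure (ℝ × H)} (h : D.WeakSol s ζ ν) {c₀ : ℝ} (hc₀ : 0 < c₀)
    (hC : ∀ x, c₀ * ‖x‖ ^ 2 ≤ ⟪D.C x, x⟫_ℝ) {B M W : ℝ} (u : ι → D.Mode)
    {w : ℝ × H → H} (hu : ∀ p : ℝ × H, p.1 ∈ Icc 0 D.T → |fval u p| ≤ B)
    (hg : ∀ p : ℝ × H, p.1 ∈ Icc 0 D.T → |fgen u p - ⟪w p, fgrad u p⟫_ℝ| ≤ M)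
    (hwi : Integrable (fun p => ‖w p‖ ^ 2) ν) (hw : ∫ p, ‖w p‖ ^ 2 ∂ν ≤ W) :
    ∫ p, ‖fgrad u p‖ ^ 2 ∂ν ≤
      2 / c₀ * (2 * B * M * ν.real univ + 2 * B ^ 2 / c₀ * W) := by
  have := h.finite
  have hgrad := h.integrable_norm_fgrad_sq u
  obtain ⟨G, hG⟩ := exists_norm_fgrad_le u
  have hi1 : Integrable (fun p => 2 * fval u p * fgen u p) ν := by
    refine (h.integrable_fgen u).bdd_mul (c := 2 * B)
      ((continuous_fval u).const_mul 2).aestronglyMeasurable ?_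
    filter_upwards [h.ae_mem_Icc] with p hp
    rw [norm_mul, Real.norm_ofNat]
    gcongr
    exact hu p hp
  have hi2 : Integrable (fun p => ⟪D.C (fgrad u p), fgrad u p⟫_ℝ) ν := by
    have hc := continuous_fgrad u
    refine (hgrad.const_mul ‖D.C‖).mono' (by fun_prop : Continuous _).aestronglyMeasurable
      (.of_forall fun p => ?_)
    calc _ ≤ ‖D.C (fgrad u p)‖ * ‖fgrad u p‖ := norm_inner_le_norm _ _
      _ ≤ ‖D.C‖ * ‖fgrad u p‖ * ‖fgrad u p‖ := by
        gcongr
        exact D.C.le_opNorm _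
      _ = _ := by ring
  have hlow : ∫ p, (c₀ / 2 * ‖fgrad u p‖ ^ 2 - (2 * B * M + 2 * B ^ 2 / c₀ * ‖w p‖ ^ 2)) ∂ν ≤
      ∫ p, (2 * fval u p * fgen u p + ⟪D.C (fgrad u p), fgrad u p⟫_ℝ) ∂ν := by
    refine integral_mono_ae ((hgrad.const_mul _).sub ((integrable_const _).add
      (hwi.const_mul _))) (hi1.add hi2) ?_
    filter_upwards [h.ae_mem_Icc] with p hp
    have e1 := hC (fgrad u p)
    have e2 := hu p hp
    have e3 : |fgen u p| ≤ M + ‖w p‖ * ‖fgrad u p‖ := by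
      have := abs_real_inner_le_norm (w p) (fgrad u p)
      calc |fgen u p| = |(fgen u p - ⟪w p, fgrad u p⟫_ℝ) + ⟪w p, fgrad u p⟫_ℝ| := by ring_nf
        _ ≤ _ := (abs_add_le _ _).trans (add_le_add (hg p hp) this)
    have e4 : |fval u p * fgen u p| ≤ B * (M + ‖w p‖ * ‖fgrad u p‖) := by
      rw [abs_mul]
      exact mul_le_mul e2 e3 (abs_nonneg _) ((abs_nonneg _).trans e2)
    have e5 : 0 ≤ c₀ / 2 * (‖fgrad u p‖ - 2 * B * ‖w p‖ / c₀) ^ 2 := by positivity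
    have e6 : c₀ / 2 * (‖fgrad u p‖ - 2 * B * ‖w p‖ / c₀) ^ 2 = c₀ / 2 * ‖fgrad u p‖ ^ 2 -
        2 * B * (‖w p‖ * ‖fgrad u p‖) + 2 * B ^ 2 / c₀ * ‖w p‖ ^ 2 := by
      field_simp
      ring
    have e7 := (abs_le.1 e4).1
    linarith
  have hle := hlow.trans (h.energy u)
  have hs : Integrable (fun p => 2 * B * M + 2 * B ^ 2 / c₀ * ‖w p‖ ^ 2) ν :=
    (integrable_const _).add (hwi.const_mul _)
  rw [integral_sub (hgrad.const_mul _) hs,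
    integral_add (integrable_const _) (hwi.const_mul _), integral_const_mul,
    integral_const_mul (2 * B ^ 2 / c₀), integral_const, smul_eq_mul] at hle
  have hW : 2 * B ^ 2 / c₀ * ∫ p, ‖w p‖ ^ 2 ∂ν ≤ 2 * B ^ 2 / c₀ * W := by gcongr
  rw [div_mul_eq_mul_div, le_div_iff₀ hc₀]
  linarith

/-- Weak solutions almost solve the adjoint problem for approximate solutions. -/
theorem WeakSol.abs_integral_fgen_sub_le {s : ℝ} {ζ : Measure H} [IsFiniteMeasure ζ]
    {ν : Measure (ℝ × H)} (h : D.WeakSol s ζ ν) {c₀ : ℝ} (hc₀ : 0 < c₀)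
    (hC : ∀ x, c₀ * ‖x‖ ^ 2 ≤ ⟪D.C x, x⟫_ℝ) {B M ε : ℝ} (hε : 0 < ε) (hε1 : ε ≤ 1)
    (u : ι → D.Mode) {w : ℝ × H → H} {f : ℝ × H → ℝ} (hfi : Integrable f ν)
    (hu : ∀ p : ℝ × H, p.1 ∈ Icc 0 D.T → |fval u p| ≤ B)
    (hf : ∀ p : ℝ × H, p.1 ∈ Icc 0 D.T → |f p| ≤ M)
    (hg : ∀ p : ℝ × H, p.1 ∈ Icc 0 D.T → |fgen u p - ⟪w p, fgrad u p⟫_ℝ - f p| ≤ ε)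
    (hwi : Integrable (fun p => ‖w p‖ ^ 2) ν) (hw : ∫ p, ‖w p‖ ^ 2 ∂ν ≤ ε ^ 2) :
    |∫ p, fgen u p ∂ν - ∫ p, f p ∂ν| ≤
      (ν.real univ + 1 / 2 * (1 + 2 / c₀ * (2 * B * (M + 1) * ν.real univ +
        2 * B ^ 2 / c₀ * 1))) * ε := by
  have := h.finite
  have hgrad := h.integrable_norm_fgrad_sq u
  have hE := h.integral_norm_fgrad_sq_le hc₀ hC (M := M + 1) (W := 1) u hu
    (fun p hp => by
      have h1 := abs_le.1 (hf p hp)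
      have h2 := abs_le.1 (hg p hp)
      rw [abs_le]
      constructor <;> linarith) hwi (hw.trans (pow_le_one₀ hε.le hε1))
  rw [← integral_sub (h.integrable_fgen u) hfi]
  have hbd : ∀ᵐ p ∂ν, ‖fgen u p - f p‖ ≤
      ε + 1 / 2 * (ε⁻¹ * ‖w p‖ ^ 2 + ε * ‖fgrad u p‖ ^ 2) := by
    filter_upwards [h.ae_mem_Icc] with p hp
    have e1 := abs_real_inner_le_norm (w p) (fgrad u p)
    have e2 : 0 ≤ ε⁻¹ * (‖w p‖ - ε * ‖fgrad u p‖) ^ 2 := by positivity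
    have e3 : ε⁻¹ * (‖w p‖ - ε * ‖fgrad u p‖) ^ 2 = ε⁻¹ * ‖w p‖ ^ 2 -
        2 * (‖w p‖ * ‖fgrad u p‖) + ε * ‖fgrad u p‖ ^ 2 := by
      field_simp
      ring
    have e4 := abs_le.1 (hg p hp)
    have e5 := abs_le.1 e1
    rw [Real.norm_eq_abs, abs_le]
    constructor <;> linarith
  have hi : Integrable (fun p => ε⁻¹ * ‖w p‖ ^ 2 + ε * ‖fgrad u p‖ ^ 2) ν :=
    (hwi.const_mul ε⁻¹).add (hgrad.const_mul ε)
  have hi' : Integrable (fun p => ε + 1 / 2 * (ε⁻¹ * ‖w p‖ ^ 2 + ε * ‖fgrad u p‖ ^ 2)) ν :=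
    (integrable_const ε).add (hi.const_mul (1 / 2))
  refine (norm_integral_le_of_norm_le hi' hbd).trans ?_
  rw [integral_add (integrable_const ε) (hi.const_mul (1 / 2)), integral_const_mul,
    integral_add (hwi.const_mul ε⁻¹) (hgrad.const_mul ε), integral_const_mul, integral_const_mul,
    integral_const, smul_eq_mul]
  have h1 : ε⁻¹ * ∫ p, ‖w p‖ ^ 2 ∂ν ≤ ε⁻¹ * ε ^ 2 := by gcongr
  have h2 : ε⁻¹ * ε ^ 2 = ε := by field_simp
  have h3 := mul_le_mul_of_nonneg_left hE hε.le
  linarith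

/-- Uniqueness of weak solutions with square-integrable drift. -/
theorem WeakSol.unique {s : ℝ} {ζ : Measure H} [IsFiniteMeasure ζ] {μ₁ μ₂ : Measure (ℝ × H)}
    (h₁ : D.WeakSol s ζ μ₁) (h₂ : D.WeakSol s ζ μ₂) {c₀ : ℝ} (hc₀ : 0 < c₀)
    (hC : ∀ x, c₀ * ‖x‖ ^ 2 ≤ ⟪D.C x, x⟫_ℝ) : μ₁ = μ₂ := by
  have := h₁.finite
  have := h₂.finite
  have hre : ∀ g : D.Src, ∫ p, (g.val p).re ∂μ₁ = ∫ p, (g.val p).re ∂μ₂ := by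
    intro g
    obtain ⟨M, hM, hg⟩ := g.exists_norm_val_le
    have hf : ∀ p : ℝ × H, p.1 ∈ Icc 0 D.T → |(g.val p).re| ≤ M := fun p hp =>
      (Complex.abs_re_le_norm _).trans (hg p hp)
    set B := (M + 1) * D.T
    obtain ⟨K, hK⟩ : ∃ K : ℝ, ∀ ε : ℝ, 0 < ε → ε ≤ 1 →
        |∫ p, (g.val p).re ∂μ₁ - ∫ p, (g.val p).re ∂μ₂| ≤ K * ε := by
      let k : Measure (ℝ × H) → ℝ := fun ν => ν.real univ + 1 / 2 * (1 + 2 / c₀ *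
        (2 * B * (M + 1) * ν.real univ + 2 * B ^ 2 / c₀ * 1))
      refine ⟨k μ₁ + k μ₂, fun ε hε hε1 => ?_⟩
      have hν : ∀ᵐ p ∂(μ₁ + μ₂), p.1 ∈ Ico 0 D.T := by
        rw [ae_add_measure_iff]
        exact ⟨h₁.time, h₂.time⟩
      have hm := h₁.memLp.1.add_measure h₂.memLp.1
      have hF : MemLp D.F 2 (μ₁ + μ₂) := (memLp_two_iff_integrable_sq_norm hm).2
        (((memLp_two_iff_integrable_sq_norm h₁.memLp.1).1 h₁.memLp).add_measure
          ((memLp_two_iff_integrable_sq_norm h₂.memLp.1).1 h₂.memLp))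
      obtain ⟨J, _, σ, a, hwi, hw⟩ := exists_cfield_approx hν hF hε
      obtain ⟨ι, _, u, hu⟩ := exists_approx_solution hc₀ hC σ a (fun _ : Unit => g) hε
      have hcsrc : ∀ p, csrc (fun _ : Unit => g) p.1 (evalChar p) = (g.val p).re := fun p => by
        rw [csrc, Fintype.sum_unique]
        rfl
      have hv : ∀ p : ℝ × H, p.1 ∈ Icc 0 D.T → |fval u p| ≤ B := fun p hp => by
        rw [fval_eq]
        refine abs_cval_le u (w := cfield σ a) (by positivity) (fun t ht θ hθ => ?_) hp
          (isChar_evalChar p)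
        have e1 := abs_le.1 (hu t ht θ hθ)
        have e2 : |csrc (fun _ : Unit => g) t θ| ≤ M := by
          rw [csrc, Fintype.sum_unique]
          refine (Complex.abs_re_le_norm _).trans ?_
          have := hg (t, 0) ht
          rw [Src.norm_val] at this
          rwa [norm_mul, Circle.norm_coe, mul_one]
        have e3 := abs_le.1 e2
        rw [abs_le]
        constructor <;> linarith
      have hgen : ∀ p : ℝ × H, p.1 ∈ Icc 0 D.T →
          |fgen u p - ⟪D.F p - cfield σ a p.1 (evalChar p), fgrad u p⟫_ℝ - (g.val p).re| ≤ ε := by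
        intro p hp
        have := hu p.1 hp _ (isChar_evalChar p)
        rw [hcsrc] at this
        rw [fgen_eq, inner_sub_left, fgrad_eq]
        convert this using 2
        ring
      have hwi' := integrable_add_measure.1 hwi
      rw [integral_add_measure hwi'.1 hwi'.2] at hw
      have hp1 : 0 ≤ ∫ p, ‖D.F p - cfield σ a p.1 (evalChar p)‖ ^ 2 ∂μ₁ :=
        integral_nonneg fun _ => by positivity
      have hp2 : 0 ≤ ∫ p, ‖D.F p - cfield σ a p.1 (evalChar p)‖ ^ 2 ∂μ₂ :=
        integral_nonneg fun _ => by positivity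
      have k1 := h₁.abs_integral_fgen_sub_le hc₀ hC hε hε1 u (g.integrable_val h₁.time).re hv hf
        hgen hwi'.1 (by linarith)
      have k2 := h₂.abs_integral_fgen_sub_le hc₀ hC hε hε1 u (g.integrable_val h₂.time).re hv hf
        hgen hwi'.2 (by linarith)
      rw [h₁.integral_fgen, abs_sub_comm] at k1
      rw [h₂.integral_fgen] at k2
      exact (abs_sub_le _ _ _).trans ((add_le_add k1 k2).trans_eq (add_mul _ _ _).symm)
    have hlim : Tendsto (fun ε : ℝ => K * ε) (𝓝[>] 0) (𝓝 (K * 0)) :=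
      ((continuous_const_mul K).tendsto 0).mono_left nhdsWithin_le_nhds
    rw [mul_zero] at hlim
    have := ge_of_tendsto hlim (b := |∫ p, (g.val p).re ∂μ₁ - ∫ p, (g.val p).re ∂μ₂|) (by
      filter_upwards [Ioc_mem_nhdsGT one_pos] with ε hε using hK ε hε.1 hε.2)
    exact sub_eq_zero.1 (abs_nonpos_iff.1 this)
  refine ext_of_src h₁.time h₂.time fun g => ?_
  have hi₁ := g.integrable_val h₁.time
  have hi₂ := g.integrable_val h₂.time
  refine Complex.ext ?_ ?_
  · rw [← RCLike.re_eq_complex_re, ← integral_re hi₁, ← integral_re hi₂]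
    exact hre g
  · rw [← RCLike.im_eq_complex_im, ← integral_im hi₁, ← integral_im hi₂]
    have := hre g.rot
    simp only [Src.re_val_rot] at this
    exact this

end FPData

end Uniqueness

section Theorems

open MeasureTheory Set Filter Topology
open scoped InnerProductSpace ENNReal NNReal

variable {H : Type} [NormedAddCommGroup H] [InnerProductSpace ℝ H] [CompleteSpace H]
  [SecondCountableTopology H] [MeasurableSpace H] [BorelSpace H]

/-- Theorem 4.1: uniqueness for the Fokker–Planck equation in the fully
non-degenerate case `C⁻¹ ∈ L(H)`. -/
theorem statement8 (D : FPData H) (hyp : D.Hyp31)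
    (Cinv : H →L[ℝ] H) (hC1 : D.C.comp Cinv = 1) (hC2 : Cinv.comp D.C = 1)
    (s : ℝ) (hs : s ∈ Icc 0 D.T) (ζ : Measure H) [IsProbabilityMeasure ζ] :
    {μ : Measure (ℝ × H) |
      ∃ μt : ℝ → Measure H, D.IsFPSol s ζ μ μt ∧ D.moment2 s μt}.Subsingleton := by
  rintro μ₁ ⟨_, h₁, m₁⟩ μ₂ ⟨_, h₂, m₂⟩
  obtain ⟨c₀, hc₀, hC⟩ := D.exists_coercive hC2
  exact (D.weakSol_of_isFPSol hs h₁ m₁).unique (D.weakSol_of_isFPSol hs h₂ m₂) hc₀ hC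

end Theorems
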